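/- Let Ω ⊂ ℝⁿ be open, u ∈ W^{1,1}_loc(Ω) ∩ L^∞_loc(Ω), and let σ ∈ L^∞_loc(Ω, ℝⁿ) have divergence representable by a Radon measure. Then for every φ ∈ C_c^∞(Ω), the pairing ⟨σ, Du⁺⟩(φ) := −∫_Ω u σ·Dφ dx − ∫_Ω φ u⁺ d(Div σ) equals ∫_Ω φ σ·Du dx, where Du is the weak (Sobolev) gradient of u. -/

import Mathlib

open MeasureTheory Set Filter Topology Metric
open scoped RealInnerProductSpace ENNReal

noncomputable section

/-- Euclidean space `ℝⁿ`. -/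
abbrev Eu (n : ℕ) : Type := EuclideanSpace ℝ (Fin n)

/-- `(n-1)`-dimensional Hausdorff measure on `ℝⁿ`. -/
def hm (n : ℕ) : Measure (Eu n) := μH[(n : ℝ) - 1]

/-- Smooth test functions compactly supported in `Ω`. -/
def IsTest {n : ℕ} (Ω : Set (Eu n)) (φ : Eu n → ℝ) : Prop :=
  ContDiff ℝ (⊤ : ℕ∞) φ ∧ HasCompactSupport φ ∧ tsupport φ ⊆ Ω

/-- `σ ∈ L^∞(Ω, ℝⁿ)` with `‖σ‖ ≤ C` a.e. on `Ω`. -/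
def Bdd {n : ℕ} (Ω : Set (Eu n)) (σ : Eu n → Eu n) (C : ℝ) : Prop :=
  AEStronglyMeasurable σ (volume.restrict Ω) ∧ ∀ᵐ x ∂(volume.restrict Ω), ‖σ x‖ ≤ C

/-- `σ ∈ L^∞_loc(Ω, ℝⁿ)`. -/
def LocBdd {n : ℕ} (Ω : Set (Eu n)) (σ : Eu n → Eu n) : Prop :=
  AEStronglyMeasurable σ (volume.restrict Ω) ∧
  ∀ K : Set (Eu n), K ⊆ Ω → IsCompact K → ∃ C : ℝ, ∀ᵐ x ∂(volume.restrict K), ‖σ x‖ ≤ C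

/-- scalar `u ∈ L^∞_loc(Ω)`. -/
def LocBddFun {n : ℕ} (Ω : Set (Eu n)) (u : Eu n → ℝ) : Prop :=
  AEStronglyMeasurable u (volume.restrict Ω) ∧
  ∀ K : Set (Eu n), K ⊆ Ω → IsCompact K → ∃ C : ℝ, ∀ᵐ x ∂(volume.restrict K), |u x| ≤ C

/-- scalar `u ∈ L^∞(Ω)` with bound `C`. -/
def BddFun {n : ℕ} (Ω : Set (Eu n)) (u : Eu n → ℝ) (C : ℝ) : Prop :=
  AEStronglyMeasurable u (volume.restrict Ω) ∧ ∀ᵐ x ∂(volume.restrict Ω), |u x| ≤ C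

/-- A measure carried by `Ω` which is finite on compact subsets of `Ω` (Radon on `Ω`). -/
def LocFinOn {n : ℕ} (Ω : Set (Eu n)) (μ : Measure (Eu n)) : Prop :=
  (∀ K : Set (Eu n), K ⊆ Ω → IsCompact K → μ K < ⊤) ∧ μ Ωᶜ = 0

/-- A finite measure carried by `Ω`. -/
def FinOn {n : ℕ} (Ω : Set (Eu n)) (μ : Measure (Eu n)) : Prop :=
  μ univ < ⊤ ∧ μ Ωᶜ = 0

/-- The (signed) measure `μp - μn` represents `-Div σ` on `Ω`: for every test function `φ`
compactly supported in `Ω` one has `∫_Ω σ·∇φ dx = ∫ φ dμp - ∫ φ dμn`. -/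
def RepNegDiv {n : ℕ} (Ω : Set (Eu n)) (σ : Eu n → Eu n) (μp μn : Measure (Eu n)) : Prop :=
  ∀ φ : Eu n → ℝ, IsTest Ω φ →
    ∫ x in Ω, ⟪σ x, gradient φ x⟫ = (∫ x, φ x ∂μp) - ∫ x, φ x ∂μn

/-- `Div σ ≤ 0` in the sense of distributions on `Ω`. -/
def DivNonpos {n : ℕ} (Ω : Set (Eu n)) (σ : Eu n → Eu n) : Prop :=
  ∀ φ : Eu n → ℝ, IsTest Ω φ → (∀ x, 0 ≤ φ x) → 0 ≤ ∫ x in Ω, ⟪σ x, gradient φ x⟫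

/-- The set `A` has Lebesgue density zero at the point `x`. -/
def DensityZeroAt {n : ℕ} (A : Set (Eu n)) (x : Eu n) : Prop :=
  Tendsto (fun r : ℝ => volume (A ∩ ball x r) / volume (ball x r)) (𝓝[>] 0) (𝓝 0)

/-- The upper (approximate) representative `u⁺`: Lebesgue value at approximate continuity
points, larger jump value at approximate jump points. -/
def upperRep {n : ℕ} (u : Eu n → ℝ) (x : Eu n) : ℝ :=
  sInf {t : ℝ | DensityZeroAt {y | t < u y} x}

/-- The lower (approximate) representative `u⁻`. -/
def lowerRep {n : ℕ} (u : Eu n → ℝ) (x : Eu n) : ℝ :=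
  sSup {t : ℝ | DensityZeroAt {y | u y < t} x}

/-- The precise (mean-value) representative `u* = (u⁺ + u⁻)/2`. -/
def preciseRep {n : ℕ} (u : Eu n → ℝ) (x : Eu n) : ℝ := (upperRep u x + lowerRep u x) / 2

/-- `Du = θ·ν` is the gradient measure of `u` on `Ω` with total variation `ν` and
polar vector `θ` (so `ν = |Du|`). -/
def HasGradMeasure {n : ℕ} (Ω : Set (Eu n)) (u : Eu n → ℝ) (ν : Measure (Eu n))
    (θ : Eu n → Eu n) : Prop :=
  (∀ᵐ x ∂ν, ‖θ x‖ = 1) ∧ ν Ωᶜ = 0 ∧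
  ∀ φ : Eu n → ℝ, IsTest Ω φ → ∫ x in Ω, u x • gradient φ x = - ∫ x, φ x • θ x ∂ν

/-- `u ∈ BV_loc(Ω)`. -/
def MemBVLoc {n : ℕ} (Ω : Set (Eu n)) (u : Eu n → ℝ) : Prop :=
  LocallyIntegrableOn u Ω ∧
  ∃ ν θ, LocFinOn Ω ν ∧ HasGradMeasure Ω u ν θ

/-- `g` is the weak (Sobolev) gradient of `u ∈ W^{1,1}(Ω)`. -/
def HasSobGrad {n : ℕ} (Ω : Set (Eu n)) (u : Eu n → ℝ) (g : Eu n → Eu n) : Prop :=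
  IntegrableOn g Ω ∧
  ∀ φ : Eu n → ℝ, IsTest Ω φ → ∫ x in Ω, u x • gradient φ x = - ∫ x in Ω, φ x • g x

/-- `u ∈ W^{1,1}(Ω)`. -/
def MemW11 {n : ℕ} (Ω : Set (Eu n)) (u : Eu n → ℝ) : Prop :=
  IntegrableOn u Ω ∧ ∃ g, HasSobGrad Ω u g

/-- `u ∈ W^{1,1}_loc(Ω)` with weak gradient `g`. -/
def HasSobGradLoc {n : ℕ} (Ω : Set (Eu n)) (u : Eu n → ℝ) (g : Eu n → Eu n) : Prop :=
  LocallyIntegrableOn g Ω ∧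
  ∀ φ : Eu n → ℝ, IsTest Ω φ → ∫ x in Ω, u x • gradient φ x = - ∫ x in Ω, φ x • g x

def MemW11Loc {n : ℕ} (Ω : Set (Eu n)) (u : Eu n → ℝ) : Prop :=
  LocallyIntegrableOn u Ω ∧ ∃ g, HasSobGradLoc Ω u g

/-- `T` is the interior trace of `u` on `∂Ω`, characterized `H^{n-1}`-a.e. on `∂Ω`
by convergence of interior mean values. -/
def IsIntTrace {n : ℕ} (Ω : Set (Eu n)) (u T : Eu n → ℝ) : Prop :=
  ∀ᵐ x ∂((hm n).restrict (frontier Ω)),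
    Tendsto (fun r : ℝ => (∫ y in Ω ∩ ball x r, |u y - T x|) / (volume (ball x r)).toReal)
      (𝓝[>] 0) (𝓝 0)

/-- The domain assumption `H^{n-1}(∂Ω) = P(Ω) < ∞`, in the equivalent form
`𝟙_Ω ∈ BV(ℝⁿ)` with `|D𝟙_Ω| = H^{n-1}⌞∂Ω`. -/
def DomainAssum {n : ℕ} (Ω : Set (Eu n)) : Prop :=
  hm n (frontier Ω) < ⊤ ∧
  ∃ θ, HasGradMeasure (univ : Set (Eu n)) (Ω.indicator fun _ => (1 : ℝ))
    ((hm n).restrict (frontier Ω)) θ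

/-- `g` is the normal trace `σ_n*` of `σ` on `∂Ω`, characterized by the Gauss–Green
formula for `W^{1,1} ∩ L^∞` functions; here `μ = -Div σ ≥ 0`. -/
def IsNormalTrace {n : ℕ} (Ω : Set (Eu n)) (σ : Eu n → Eu n) (μ : Measure (Eu n))
    (g : Eu n → ℝ) : Prop :=
  ∀ (v : Eu n → ℝ) (gv : Eu n → Eu n) (T : Eu n → ℝ),
    MemW11 Ω v → (∃ C, BddFun Ω v C) → HasSobGrad Ω v gv → IsIntTrace Ω v T →
    ∀ φ : Eu n → ℝ, IsTest (univ : Set (Eu n)) φ →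
      (- ∫ x in Ω, v x * ⟪σ x, gradient φ x⟫) + (∫ x, φ x * preciseRep v x ∂μ)
        = (∫ x in Ω, φ x * ⟪σ x, gv x⟫) + ∫ x in frontier Ω, φ x * T x * g x ∂(hm n)

/-- Weakly super-1-harmonic: there is `σ ∈ L^∞` with `|σ| ≤ 1` a.e., `Div σ ≤ 0`,
and `⟨σ, Du⁺⟩ = |Du|` as measures on `Ω`. -/
def SuperOneHarmonic {n : ℕ} (Ω : Set (Eu n)) (u : Eu n → ℝ) : Prop :=
  MemBVLoc Ω u ∧ LocBddFun Ω u ∧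
  ∃ σ : Eu n → Eu n, ∃ μ : Measure (Eu n),
    Bdd Ω σ 1 ∧ DivNonpos Ω σ ∧ RepNegDiv Ω σ μ 0 ∧ LocFinOn Ω μ ∧
    ∃ ν θ, LocFinOn Ω ν ∧ HasGradMeasure Ω u ν θ ∧
      ∀ φ : Eu n → ℝ, IsTest Ω φ →
        (- ∫ x in Ω, u x * ⟪σ x, gradient φ x⟫) + (∫ x, φ x * upperRep u x ∂μ)
          = ∫ x, φ x ∂ν

theorem lintegral_comp_smul_add {n : ℕ} {F : Eu n → ℝ≥0∞} (hF : Measurable F) {a : ℝ}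
    (ha : a ≠ 0) (b : Eu n) :
    ∫⁻ x, F (a • x + b) = ENNReal.ofReal |(a ^ n)⁻¹| * ∫⁻ x, F x := by
  have h1 : ∫⁻ x, F (a • x + b) = ∫⁻ z, F (z + b) ∂(Measure.map (a • ·) (volume : Measure (Eu n))) := by
    rw [lintegral_map (by fun_prop) (by fun_prop)]
  rw [h1, Measure.map_addHaar_smul volume ha, lintegral_smul_measure,
    lintegral_add_right_eq_self F b, finrank_euclideanSpace_fin, smul_eq_mul]

theorem setLIntegral_ball_comp_segment_le {n : ℕ} {F : Eu n → ℝ≥0∞} (hF : Measurable F)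
    {c y : Eu n} {r s : ℝ} (hy : y ∈ ball c r) (hs : s ∈ Icc (0 : ℝ) (1 / 2)) :
    ∫⁻ x in ball c r, F (x + s • (y - x)) ≤ 2 ^ n * ∫⁻ z in ball c r, F z := by
  have hs1 : (1 - s) ≠ 0 := by have := hs.2; linarith
  have h1 : ∀ x ∈ ball c r, F (x + s • (y - x)) ≤
      (ball c r).indicator F ((1 - s) • x + s • y) := by
    intro x hx
    have e : x + s • (y - x) = (1 - s) • x + s • y := by module
    have : (1 - s) • x + s • y ∈ ball c r :=
      (convex_ball c r) hx hy (by linarith [hs.2]) hs.1 (by ring)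
    rw [indicator_of_mem this, e]
  calc ∫⁻ x in ball c r, F (x + s • (y - x))
      ≤ ∫⁻ x in ball c r, (ball c r).indicator F ((1 - s) • x + s • y) :=
        setLIntegral_mono' measurableSet_ball h1
    _ ≤ ∫⁻ x, (ball c r).indicator F ((1 - s) • x + s • y) := setLIntegral_le_lintegral _ _
    _ = ENNReal.ofReal |((1 - s) ^ n)⁻¹| * ∫⁻ x in ball c r, F x := by
        rw [lintegral_comp_smul_add (hF.indicator measurableSet_ball) hs1,
          lintegral_indicator measurableSet_ball]
    _ ≤ 2 ^ n * ∫⁻ z in ball c r, F z := by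
        gcongr
        rw [← inv_pow, abs_pow, ENNReal.ofReal_pow (abs_nonneg _)]
        gcongr
        rw [abs_inv]
        refine ENNReal.ofReal_le_of_le_toReal ?_
        rw [abs_of_pos (by linarith [hs.2])]
        have : (0 : ℝ) < 1 / 2 := by norm_num
        calc (1 - s)⁻¹ ≤ (1 / 2)⁻¹ := inv_anti₀ this (by linarith [hs.2])
          _ = _ := by norm_num

theorem enorm_sub_midpoint_le {n : ℕ} {w : Eu n → ℝ} (hw : ContDiff ℝ 1 w) (x y : Eu n) :
    ‖w x - w (x + (1 / 2 : ℝ) • (y - x))‖ₑ ≤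
      ∫⁻ s in Ioc (0 : ℝ) (1 / 2), ‖fderiv ℝ w (x + s • (y - x))‖ₑ * ‖y - x‖ₑ := by
  have hd : ∀ s : ℝ, HasDerivAt (fun s : ℝ => w (x + s • (y - x)))
      (fderiv ℝ w (x + s • (y - x)) (y - x)) s := by
    intro s
    have h1 : HasDerivAt (fun s : ℝ => x + s • (y - x)) (y - x) s := by
      simpa using ((hasDerivAt_id s).smul_const (y - x)).const_add x
    exact ((hw.differentiable one_ne_zero _).hasFDerivAt).comp_hasDerivAt s h1
  have hc : Continuous fun s : ℝ => fderiv ℝ w (x + s • (y - x)) (y - x) := by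
    have := hw.continuous_fderiv one_ne_zero
    fun_prop
  have h2 := intervalIntegral.integral_eq_sub_of_hasDerivAt (a := 0) (b := 1 / 2)
    (fun s _ => hd s) (hc.intervalIntegrable _ _)
  rw [intervalIntegral.integral_of_le (by norm_num)] at h2
  rw [← enorm_neg, neg_sub]
  simp only [zero_smul, add_zero] at h2
  rw [← h2]
  refine (enorm_integral_le_lintegral_enorm _).trans (lintegral_mono fun s => ?_)
  exact ContinuousLinearMap.le_opENorm _ _

/-- The double-integral form of the `L¹` Poincaré inequality on balls. -/
theorem poincare_ball {n : ℕ} {w : Eu n → ℝ} (hw : ContDiff ℝ 1 w) (c : Eu n) {r : ℝ}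
    (hr : 0 < r) :
    ∫⁻ x in ball c r, ∫⁻ y in ball c r, ‖w x - w y‖ₑ ≤
      2 ^ (n + 1) * ENNReal.ofReal r * volume (ball c r) *
        ∫⁻ z in ball c r, ‖fderiv ℝ w z‖ₑ := by
  have hfc := hw.continuous_fderiv one_ne_zero
  have hwc := hw.continuous
  set B := ball c r
  set m : Eu n → Eu n → Eu n := fun x y => x + (1 / 2 : ℝ) • (y - x) with hm
  have hmsymm : ∀ x y, m x y = m y x := fun x y => by simp only [hm]; module
  have key : ∫⁻ x in B, ∫⁻ y in B, ‖w x - w (m x y)‖ₑ ≤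
      2 ^ n * ENNReal.ofReal r * volume B * ∫⁻ z in B, ‖fderiv ℝ w z‖ₑ := by
    have hnorm : ∀ x ∈ B, ∀ y ∈ B, ‖y - x‖ₑ ≤ ENNReal.ofReal (2 * r) := by
      intro x hx y hy
      rw [← ofReal_norm, ← dist_eq_norm]
      refine ENNReal.ofReal_le_ofReal ?_
      have := dist_triangle_right y x c
      have := mem_ball.1 hx
      have := mem_ball.1 hy
      linarith
    calc ∫⁻ x in B, ∫⁻ y in B, ‖w x - w (m x y)‖ₑ
        ≤ ∫⁻ x in B, ∫⁻ y in B, ∫⁻ s in Ioc (0 : ℝ) (1 / 2),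
            ‖fderiv ℝ w (x + s • (y - x))‖ₑ * ENNReal.ofReal (2 * r) := by
          refine setLIntegral_mono' measurableSet_ball fun x hx => ?_
          refine setLIntegral_mono' measurableSet_ball fun y hy => ?_
          refine (enorm_sub_midpoint_le hw x y).trans ?_
          gcongr
          exact hnorm x hx y hy
      _ = ∫⁻ y in B, ∫⁻ x in B, ∫⁻ s in Ioc (0 : ℝ) (1 / 2),
            ‖fderiv ℝ w (x + s • (y - x))‖ₑ * ENNReal.ofReal (2 * r) := by
          refine lintegral_lintegral_swap ?_
          refine Measurable.aemeasurable ?_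
          refine Measurable.lintegral_prod_right' (f := fun p : (Eu n × Eu n) × ℝ =>
            ‖fderiv ℝ w (p.1.1 + p.2 • (p.1.2 - p.1.1))‖ₑ * ENNReal.ofReal (2 * r)) ?_
          refine Measurable.mul_const ?_ _
          refine Continuous.measurable ?_
          fun_prop
      _ = ∫⁻ y in B, ∫⁻ s in Ioc (0 : ℝ) (1 / 2), ∫⁻ x in B,
            ‖fderiv ℝ w (x + s • (y - x))‖ₑ * ENNReal.ofReal (2 * r) := by
          refine lintegral_congr fun y => lintegral_lintegral_swap ?_
          refine Measurable.aemeasurable ?_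
          refine Measurable.mul_const ?_ _
          refine Continuous.measurable ?_
          fun_prop
      _ ≤ ∫⁻ y in B, ∫⁻ s in Ioc (0 : ℝ) (1 / 2),
            2 ^ n * (∫⁻ z in B, ‖fderiv ℝ w z‖ₑ) * ENNReal.ofReal (2 * r) := by
          refine setLIntegral_mono' measurableSet_ball fun y hy => ?_
          refine setLIntegral_mono' measurableSet_Ioc fun s hs => ?_
          rw [lintegral_mul_const _ (Continuous.measurable (by fun_prop))]
          gcongr
          exact setLIntegral_ball_comp_segment_le (F := fun z => ‖fderiv ℝ w z‖ₑ)
            (Continuous.measurable (by fun_prop)) hy ⟨hs.1.le, hs.2⟩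
      _ = 2 ^ n * ENNReal.ofReal r * volume B * ∫⁻ z in B, ‖fderiv ℝ w z‖ₑ := by
          simp only [lintegral_const, Measure.restrict_apply MeasurableSet.univ, univ_inter,
            Real.volume_Ioc, sub_zero]
          have : ENNReal.ofReal (2 * r) * ENNReal.ofReal (1 / 2) = ENNReal.ofReal r := by
            rw [← ENNReal.ofReal_mul (by positivity)]; congr 1; ring
          rw [mul_assoc (2 ^ n * _), this]; ring
  have meas1 : Measurable fun p : Eu n × Eu n => ‖w p.1 - w (m p.1 p.2)‖ₑ := by
    refine Continuous.measurable ?_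
    simp only [hm]; fun_prop
  calc ∫⁻ x in B, ∫⁻ y in B, ‖w x - w y‖ₑ
      ≤ ∫⁻ x in B, ∫⁻ y in B, (‖w x - w (m x y)‖ₑ + ‖w y - w (m y x)‖ₑ) := by
        refine lintegral_mono fun x => lintegral_mono fun y => ?_
        have : w x - w y = (w x - w (m x y)) - (w y - w (m y x)) := by rw [hmsymm x y]; ring
        simp only []
        rw [this]
        exact enorm_sub_le
    _ = (∫⁻ x in B, ∫⁻ y in B, ‖w x - w (m x y)‖ₑ) +
          ∫⁻ x in B, ∫⁻ y in B, ‖w y - w (m y x)‖ₑ := by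
        rw [← lintegral_add_left (Measurable.lintegral_prod_right' meas1)]
        refine lintegral_congr fun x => ?_
        exact lintegral_add_left (meas1.comp (by fun_prop : Measurable fun y => (x, y))) _
    _ = (∫⁻ x in B, ∫⁻ y in B, ‖w x - w (m x y)‖ₑ) +
          ∫⁻ x in B, ∫⁻ y in B, ‖w x - w (m x y)‖ₑ := by
        congr 1
        exact lintegral_lintegral_swap (meas1.comp measurable_swap).aemeasurable
    _ ≤ _ := by
        refine (add_le_add key key).trans (le_of_eq ?_)
        ring

theorem norm_gradient_eq {n : ℕ} (w : Eu n → ℝ) (x : Eu n) :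
    ‖gradient w x‖ = ‖fderiv ℝ w x‖ := by
  simp [gradient]

/-- The `C¹` functions `f l` converge to `h` almost everywhere and their gradients
converge to `q` in `L¹`. -/
def SmoothApprox {n : ℕ} (h : Eu n → ℝ) (q : Eu n → Eu n) (f : ℕ → Eu n → ℝ) : Prop :=
  (∀ l, ContDiff ℝ 1 (f l)) ∧ (∀ᵐ x, Tendsto (fun l => f l x) atTop (𝓝 (h x))) ∧
    Tendsto (fun l => ∫⁻ x, ‖gradient (f l) x - q x‖ₑ) atTop (𝓝 0)

theorem SmoothApprox.sub {n : ℕ} {h : Eu n → ℝ} {q : Eu n → Eu n} {f : ℕ → Eu n → ℝ}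
    (hf : SmoothApprox h q f) {w : Eu n → ℝ} (hw : ContDiff ℝ 1 w) :
    SmoothApprox (fun x => h x - w x) (fun x => q x - gradient w x)
      (fun l x => f l x - w x) := by
  refine ⟨fun l => (hf.1 l).sub hw, ?_, ?_⟩
  · filter_upwards [hf.2.1] with x hx using hx.sub_const _
  · convert hf.2.2 using 5 with l x
    have : gradient (fun y => f l y - w y) x = gradient (f l) x - gradient w x := by
      simp only [gradient]
      rw [fderiv_fun_sub ((hf.1 l).differentiable one_ne_zero x)
        (hw.differentiable one_ne_zero x), map_sub]
    rw [this]; exact sub_sub_sub_cancel_right _ _ _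

theorem SmoothApprox.poincare {n : ℕ} {h : Eu n → ℝ} {q : Eu n → Eu n} {f : ℕ → Eu n → ℝ}
    (hf : SmoothApprox h q f) (hq : Integrable q) {T : ℝ → ℝ} (hT : ContDiff ℝ 1 T) {C : ℝ}
    (hC : ∀ s, |deriv T s| ≤ C) (c : Eu n) {r : ℝ} (hr : 0 < r) :
    ∫⁻ x in ball c r, ∫⁻ y in ball c r, ‖T (h x) - T (h y)‖ₑ ≤
      2 ^ (n + 1) * ENNReal.ofReal r * volume (ball c r) *
        ∫⁻ z in ball c r, ‖deriv T (h z)‖ₑ * ‖q z‖ₑ := by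
  obtain ⟨hf1, hf2, hf3⟩ := hf
  set B := ball c r
  have hTc := hT.continuous
  have hT'c : Continuous (deriv T) := hT.continuous_deriv le_rfl
  set K : ℝ≥0∞ := 2 ^ (n + 1) * ENNReal.ofReal r * volume B with hK
  have hKtop : K ≠ ⊤ := by
    refine ENNReal.mul_ne_top (ENNReal.mul_ne_top (by simp) (by simp)) measure_ball_lt_top.ne
  have hfc : ∀ l, Continuous (f l) := fun l => (hf1 l).continuous
  have hgc : ∀ l, Continuous (gradient (f l)) := fun l => by
    have := (hf1 l).continuous_fderiv one_ne_zero
    unfold gradient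
    fun_prop
  have hf2' : ∀ᵐ x ∂(volume.restrict B), Tendsto (fun l => f l x) atTop (𝓝 (h x)) :=
    ae_restrict_of_ae hf2
  have meas : ∀ l, Measurable fun p : Eu n × Eu n => ‖T (f l p.1) - T (f l p.2)‖ₑ := by
    intro l
    have := hfc l
    exact Continuous.measurable (by fun_prop)
  have fatou : ∫⁻ x in B, ∫⁻ y in B, ‖T (h x) - T (h y)‖ₑ ≤
      liminf (fun l => ∫⁻ x in B, ∫⁻ y in B, ‖T (f l x) - T (f l y)‖ₑ) atTop := by
    refine le_trans ?_ (lintegral_liminf_le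
      (fun l => Measurable.lintegral_prod_right' (meas l)))
    refine lintegral_mono_ae ?_
    filter_upwards [hf2'] with x hx
    refine le_trans ?_ (lintegral_liminf_le
      (fun l => (meas l).comp (by fun_prop : Measurable fun y => (x, y))))
    refine lintegral_mono_ae ?_
    filter_upwards [hf2'] with y hy
    refine le_of_eq (Tendsto.liminf_eq ?_).symm
    exact (((hTc.tendsto _).comp hx).sub ((hTc.tendsto _).comp hy)).enorm
  have bound : ∀ l, ∫⁻ x in B, ∫⁻ y in B, ‖T (f l x) - T (f l y)‖ₑ ≤
      K * ((∫⁻ z in B, ‖deriv T (f l z)‖ₑ * ‖q z‖ₑ) +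
        ENNReal.ofReal C * ∫⁻ z, ‖gradient (f l) z - q z‖ₑ) := by
    intro l
    refine (poincare_ball (w := fun x => T (f l x)) (hT.comp (hf1 l)) c hr).trans ?_
    gcongr
    have hpt : ∀ z, ‖fderiv ℝ (fun x => T (f l x)) z‖ₑ ≤
        ‖deriv T (f l z)‖ₑ * ‖q z‖ₑ + ENNReal.ofReal C * ‖gradient (f l) z - q z‖ₑ := by
      intro z
      have hd : fderiv ℝ (fun x => T (f l x)) z = deriv T (f l z) • fderiv ℝ (f l) z := by
        have h1 := ((hT.differentiable one_ne_zero (f l z)).hasDerivAt).comp_hasFDerivAt z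
          (((hf1 l).differentiable one_ne_zero z).hasFDerivAt)
        exact h1.fderiv
      have hg : ‖fderiv ℝ (f l) z‖ₑ ≤ ‖q z‖ₑ + ‖gradient (f l) z - q z‖ₑ := by
        have : ‖fderiv ℝ (f l) z‖ₑ = ‖gradient (f l) z‖ₑ := by
          rw [← ofReal_norm, ← ofReal_norm, norm_gradient_eq]
        rw [this]
        calc ‖gradient (f l) z‖ₑ = ‖q z + (gradient (f l) z - q z)‖ₑ := by congr 1; abel
          _ ≤ _ := enorm_add_le _ _
      rw [hd, enorm_smul]
      calc ‖deriv T (f l z)‖ₑ * ‖fderiv ℝ (f l) z‖ₑ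
          ≤ ‖deriv T (f l z)‖ₑ * (‖q z‖ₑ + ‖gradient (f l) z - q z‖ₑ) := by gcongr
        _ ≤ _ := by
          rw [mul_add]
          gcongr
          rw [← ofReal_norm]
          exact ENNReal.ofReal_le_ofReal (hC _)
    refine (lintegral_mono hpt).trans ?_
    rw [lintegral_add_left']
    · gcongr
      rw [lintegral_const_mul' _ _ ENNReal.ofReal_ne_top]
      gcongr
      exact Measure.restrict_le_self
    · have := hfc l
      exact (Continuous.measurable (by fun_prop)).aemeasurable.mul
        hq.1.restrict.enorm
  have lim1 : Tendsto (fun l => ∫⁻ z in B, ‖deriv T (f l z)‖ₑ * ‖q z‖ₑ) atTop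
      (𝓝 (∫⁻ z in B, ‖deriv T (h z)‖ₑ * ‖q z‖ₑ)) := by
    refine tendsto_lintegral_of_dominated_convergence' (fun z => ENNReal.ofReal C * ‖q z‖ₑ)
      (fun l => ?_) (fun l => ?_) ?_ ?_
    · have := hfc l
      exact (Continuous.measurable (by fun_prop)).aemeasurable.mul hq.1.restrict.enorm
    · refine Eventually.of_forall fun z => ?_
      simp only []
      gcongr
      rw [← ofReal_norm]
      exact ENNReal.ofReal_le_ofReal (hC _)
    · rw [lintegral_const_mul' _ _ ENNReal.ofReal_ne_top]
      exact ENNReal.mul_ne_top ENNReal.ofReal_ne_top hq.restrict.2.ne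
    · filter_upwards [hf2'] with z hz
      exact ENNReal.Tendsto.mul_const (((hT'c.tendsto _).comp hz).enorm) (Or.inr (by simp))
  have lim2 : Tendsto (fun l => K * ((∫⁻ z in B, ‖deriv T (f l z)‖ₑ * ‖q z‖ₑ) +
        ENNReal.ofReal C * ∫⁻ z, ‖gradient (f l) z - q z‖ₑ)) atTop
      (𝓝 (K * ∫⁻ z in B, ‖deriv T (h z)‖ₑ * ‖q z‖ₑ)) := by
    refine ENNReal.Tendsto.const_mul ?_ (Or.inr hKtop)
    have := lim1.add (ENNReal.Tendsto.const_mul hf3 (Or.inr (ENNReal.ofReal_ne_top (r := C))))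
    simpa using this
  refine fatou.trans ?_
  rw [← lim2.liminf_eq]
  exact liminf_le_liminf (Eventually.of_forall bound)

theorem deriv_smoothTransition_eq_zero {s : ℝ} (hs : s < 0 ∨ 1 < s) :
    deriv Real.smoothTransition s = 0 := by
  rcases hs with hs | hs
  · have : Real.smoothTransition =ᶠ[𝓝 s] fun _ => (0 : ℝ) := by
      filter_upwards [Iio_mem_nhds hs] with x hx
      exact Real.smoothTransition.zero_of_nonpos (le_of_lt hx)
    rw [this.deriv_eq]; simp
  · have : Real.smoothTransition =ᶠ[𝓝 s] fun _ => (1 : ℝ) := by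
      filter_upwards [Ioi_mem_nhds hs] with x hx
      exact Real.smoothTransition.one_of_one_le (le_of_lt hx)
    rw [this.deriv_eq]; simp

theorem exists_bound_deriv_smoothTransition :
    ∃ L : ℝ, 0 < L ∧ ∀ s, |deriv Real.smoothTransition s| ≤ L := by
  have hc : Continuous (deriv Real.smoothTransition) :=
    (Real.smoothTransition.contDiff (n := 1)).continuous_deriv (by simp)
  have hs : HasCompactSupport (deriv Real.smoothTransition) := by
    refine HasCompactSupport.intro (isCompact_Icc (a := (0 : ℝ)) (b := 1)) fun x hx => ?_
    refine deriv_smoothTransition_eq_zero ?_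
    by_contra! h
    exact hx ⟨h.1, h.2⟩
  obtain ⟨C, hC⟩ := hs.exists_bound_of_continuous hc
  exact ⟨max C 1, by positivity, fun s => (hC s).trans (le_max_left _ _)⟩

/-- Smooth even step functions rising from `0` to `1` across `|s| ∈ [t - ε, t + ε]`. -/
theorem exists_smooth_step :
    ∃ L : ℝ, 0 < L ∧ ∀ t ε : ℝ, 0 < ε → ε < t → ∃ T : ℝ → ℝ, ContDiff ℝ 1 T ∧
      (∀ s, |s| ≤ t - ε → T s = 0) ∧ (∀ s, t + ε ≤ |s| → T s = 1) ∧
      (∀ s, |deriv T s| ≤ L / ε) ∧ ∀ s, ε < |(|s| - t)| → deriv T s = 0 := by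
  obtain ⟨L, hL, hbound⟩ := exists_bound_deriv_smoothTransition
  refine ⟨L, hL, fun t ε hε hεt => ?_⟩
  have ht : 0 < t := hε.trans hεt
  have hden : 0 < 4 * t * ε := by positivity
  set a : ℝ → ℝ := fun s => (s ^ 2 - (t - ε) ^ 2) / (4 * t * ε) with ha
  have hder : ∀ s, HasDerivAt (fun s => Real.smoothTransition (a s))
      (deriv Real.smoothTransition (a s) * (2 * s / (4 * t * ε))) s := by
    intro s
    have h1 : HasDerivAt a (2 * s / (4 * t * ε)) s := by
      simpa using (((hasDerivAt_id s).pow 2).sub_const ((t - ε) ^ 2)).div_const (4 * t * ε)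
    exact (((Real.smoothTransition.contDiff (n := 1)).differentiable
      (by simp)) (a s)).hasDerivAt.comp s h1
  have hle : ∀ s, |s| ≤ t - ε → a s ≤ 0 := by
    intro s hs
    refine div_nonpos_of_nonpos_of_nonneg ?_ hden.le
    have := sq_le_sq' (by linarith [abs_nonneg s]) hs
    rw [sq_abs] at this
    linarith
  have hge : ∀ s, t + ε ≤ |s| → 1 ≤ a s := by
    intro s hs
    rw [ha, le_div_iff₀ hden]
    have := sq_le_sq' (by linarith) hs
    rw [sq_abs] at this
    nlinarith
  have hzero : ∀ s, ε < |(|s| - t)| →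
      deriv (fun s => Real.smoothTransition (a s)) s = 0 := by
    intro s hs
    rw [(hder s).deriv, deriv_smoothTransition_eq_zero, zero_mul]
    rcases lt_abs.1 hs with h | h
    · right
      rw [ha, lt_div_iff₀ hden]
      have := sq_lt_sq' (by linarith) (show t + ε < |s| by linarith)
      rw [sq_abs] at this
      nlinarith
    · left
      refine div_neg_of_neg_of_pos ?_ hden
      have := sq_lt_sq' (by linarith [abs_nonneg s]) (show |s| < t - ε by linarith)
      rw [sq_abs] at this
      linarith
  refine ⟨fun s => Real.smoothTransition (a s), ?_, fun s hs => ?_, fun s hs => ?_,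
    fun s => ?_, hzero⟩
  · exact (Real.smoothTransition.contDiff (n := 1)).comp (by rw [ha]; fun_prop)
  · exact Real.smoothTransition.zero_of_nonpos (hle s hs)
  · exact Real.smoothTransition.one_of_one_le (hge s hs)
  · by_cases hs : ε < |(|s| - t)|
    · rw [hzero s hs, abs_zero]; positivity
    · push Not at hs
      have hs' : |s| ≤ 2 * t := by linarith [(abs_le.1 hs).2]
      rw [(hder s).deriv, abs_mul, div_eq_mul_inv L]
      refine mul_le_mul (hbound _) ?_ (abs_nonneg _) hL.le
      rw [abs_div, abs_of_pos hden, div_le_iff₀ hden, abs_mul, abs_two]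
      have : ε⁻¹ * (4 * t * ε) = 4 * t := by field_simp
      rw [this]; linarith

/-- A finite measure on the line has, on every interval, a point outside a given countable set at
which its density is at most its average. -/
theorem exists_level {m : Measure ℝ} [IsFiniteMeasure m] {S : Set ℝ} (hS : S.Countable)
    {a b : ℝ} (hab : a < b) {κ : ℝ≥0∞} (hκ : κ ≠ 0) :
    ∃ t ∈ Ioo a b, t ∉ S ∧ ∀ᶠ ε in 𝓝[>] (0 : ℝ),
      m (closedBall t ε) ≤ ENNReal.ofReal (2 * ε) *
        (m univ / ENNReal.ofReal (b - a) + κ) := by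
  have hpos := measure_le_setLAverage_pos (μ := volume) (s := Ioo a b) (f := m.rnDeriv volume)
    (by simp [hab]) (by simp) (Measure.measurable_rnDeriv _ _).aemeasurable
  have hae : ∀ᵐ t : ℝ, t ∉ S ∧ Tendsto (fun r => m (closedBall t r) / volume (closedBall t r))
      (𝓝[>] 0) (𝓝 (m.rnDeriv volume t)) :=
    (hS.ae_notMem volume).and (Besicovitch.ae_tendsto_rnDeriv m volume)
  obtain ⟨t, ⟨ht, hle⟩, htS, hlim⟩ :
      ∃ t, t ∈ {x | x ∈ Ioo a b ∧ m.rnDeriv volume x ≤ ⨍⁻ y in Ioo a b, m.rnDeriv volume y ∂volume} ∧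
        t ∉ S ∧ Tendsto (fun r => m (closedBall t r) / volume (closedBall t r))
      (𝓝[>] 0) (𝓝 (m.rnDeriv volume t)) := by
    by_contra! hcon
    refine hpos.ne' (measure_mono_null (fun t ht => ?_) hae)
    intro h
    exact hcon t ht h.1 h.2
  refine ⟨t, ht, htS, ?_⟩
  have hle' : m.rnDeriv volume t ≤ m univ / ENNReal.ofReal (b - a) := by
    refine hle.trans ?_
    rw [setLAverage_eq, Real.volume_Ioo]
    gcongr
    exact (setLIntegral_le_lintegral _ _).trans Measure.lintegral_rnDeriv_le
  have hfin : m univ / ENNReal.ofReal (b - a) ≠ ⊤ :=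
    ENNReal.div_ne_top (measure_ne_top _ _) (by simp [hab])
  have hlt : m.rnDeriv volume t < m univ / ENNReal.ofReal (b - a) + κ :=
    hle'.trans_lt (ENNReal.lt_add_right hfin hκ)
  filter_upwards [hlim.eventually_lt_const hlt, self_mem_nhdsWithin] with ε hε hε0
  rw [Real.volume_closedBall] at hε
  have := (ENNReal.div_le_iff (by simpa using hε0) ENNReal.ofReal_ne_top).1 hε.le
  rwa [mul_comm] at this

theorem volume_ball_two_mul {n : ℕ} (x : Eu n) {r : ℝ} (hr : 0 < r) :
    volume (ball x (2 * r)) = 2 ^ n * volume (ball x r) := by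
  rw [Measure.addHaar_ball_of_pos volume x hr,
    Measure.addHaar_ball_of_pos volume x (by positivity : 0 < 2 * r), mul_pow,
    ENNReal.ofReal_mul (by positivity), finrank_euclideanSpace_fin,
    ENNReal.ofReal_pow (by positivity)]
  simp [mul_assoc]

/-- If `A` has small total volume but relatively large density at some small radius, then at
some radius at most `2` its density is bounded above and below. -/
theorem exists_balanced_radius {n : ℕ} {A : Set (Eu n)} {x : Eu n} {a : ℝ≥0∞}
    (hA : volume A < a * volume (ball (0 : Eu n) 1))
    (hx : ∃ r > 0, a * volume (ball x r) < volume (A ∩ ball x r)) :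
    ∃ ρ : ℝ, 0 < ρ ∧ ρ ≤ 2 ∧ volume (A ∩ ball x ρ) ≤ a * volume (ball x ρ) ∧
      a * volume (ball x ρ) ≤ 2 ^ n * volume (A ∩ ball x ρ) := by
  obtain ⟨r, hr, hxr⟩ := hx
  set P : ℕ → Prop := fun j => a * volume (ball x (2 ^ j * r)) < volume (A ∩ ball x (2 ^ j * r))
  have hP0 : P 0 := by simpa [P] using hxr
  have hP1 : ∀ j, P j → 2 ^ j * r < 1 := by
    intro j hj
    by_contra! h
    have h1 : a * volume (ball x 1) ≤ a * volume (ball x (2 ^ j * r)) := by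
      gcongr
    have h2 : volume (ball x 1) = volume (ball (0 : Eu n) 1) :=
      Measure.addHaar_ball_center volume x 1
    rw [h2] at h1
    exact absurd (h1.trans_lt (hj.trans_le (measure_mono inter_subset_left))) hA.not_gt
  have hex : ∃ j, ¬ P j := by
    obtain ⟨j, hj⟩ := pow_unbounded_of_one_lt (1 / r) (one_lt_two (α := ℝ))
    refine ⟨j, fun h => absurd (hP1 j h) ?_⟩
    rw [div_lt_iff₀ hr] at hj
    linarith
  classical
  obtain ⟨j, hj⟩ : ∃ j, Nat.find hex = j + 1 :=
    Nat.exists_eq_succ_of_ne_zero fun h => by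
      have := Nat.find_spec hex
      rw [h] at this
      exact this hP0
  have hPj : P j := by
    have := Nat.find_min hex (m := j) (by omega)
    simpa using this
  have hPj1 : ¬ P (j + 1) := hj ▸ Nat.find_spec hex
  have e : (2 : ℝ) ^ (j + 1) * r = 2 * (2 ^ j * r) := by ring
  simp only [P, e] at hPj hPj1
  have hpos : 0 < 2 ^ j * r := by positivity
  refine ⟨2 * (2 ^ j * r), by positivity, by linarith [hP1 j hPj], not_lt.1 hPj1, ?_⟩
  rw [volume_ball_two_mul x hpos, mul_left_comm]
  gcongr
  refine hPj.le.trans (measure_mono (inter_subset_inter_right _ (ball_subset_ball ?_)))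
  linarith

/-- A ball in which both `{t < |h|}` and its complement occupy a definite fraction carries a
definite amount of the gradient of any smooth step of `h` across the level `t`. -/
theorem SmoothApprox.volume_div_radius_le {n : ℕ} {h : Eu n → ℝ} {q : Eu n → Eu n}
    {f : ℕ → Eu n → ℝ} (hf : SmoothApprox h q f) (hh : Measurable h) (hq : Integrable q)
    {T : ℝ → ℝ} {L t ε : ℝ} (hε : 0 < ε) (hT : ContDiff ℝ 1 T)
    (hT0 : ∀ s, |s| ≤ t - ε → T s = 0) (hT1 : ∀ s, t + ε ≤ |s| → T s = 1)
    (hTd : ∀ s, |deriv T s| ≤ L / ε) (hTz : ∀ s, ε < |(|s| - t)| → deriv T s = 0)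
    {x : Eu n} {ρ : ℝ} (hρ : 0 < ρ) {b : ℝ≥0∞} (hb0 : b ≠ 0) (hb : b ≤ 1 / 4)
    (hup : volume ({y | t < |h y|} ∩ ball x ρ) ≤ 1 / 2 * volume (ball x ρ))
    (hlow : 2 * b * volume (ball x ρ) ≤ volume ({y | t < |h y|} ∩ ball x ρ))
    (hstrip : volume ({y | |(|h y| - t)| ≤ ε} ∩ ball x ρ) ≤ b * volume (ball x ρ)) :
    volume (ball x ρ) / ENNReal.ofReal ρ ≤
      2 ^ (n + 1) * (b ^ 2)⁻¹ * ENNReal.ofReal (L / ε) *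
        ∫⁻ z in {y | |(|h y| - t)| ≤ ε} ∩ ball x ρ, ‖q z‖ₑ := by
  have hbt : b ≠ ⊤ := (hb.trans_lt (by simp)).ne
  set B := ball x ρ
  set V := volume B
  have hV0 : V ≠ 0 := (measure_ball_pos volume x hρ).ne'
  have hVt : V ≠ ⊤ := measure_ball_lt_top.ne
  set A : Set (Eu n) := {y | t < |h y|}
  set S : Set (Eu n) := {y | |(|h y| - t)| ≤ ε}
  have hAm : MeasurableSet A := measurableSet_lt (by fun_prop) (by fun_prop)
  have hSm : MeasurableSet S := measurableSet_le (by fun_prop) (by fun_prop)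
  set P : Set (Eu n) := {y | t + ε ≤ |h y|} ∩ B
  set N : Set (Eu n) := {y | |h y| ≤ t - ε} ∩ B
  have hPm : MeasurableSet P := (measurableSet_le (by fun_prop) (by fun_prop)).inter
    measurableSet_ball
  have hNm : MeasurableSet N := (measurableSet_le (by fun_prop) (by fun_prop)).inter
    measurableSet_ball
  have hbV : b * V ≠ ⊤ := ENNReal.mul_ne_top hbt hVt
  have hP : b * V ≤ volume P := by
    have h1 : A ∩ B ⊆ P ∪ S ∩ B := by
      rintro y ⟨hy, hyB⟩
      have hy : t < |h y| := hy
      by_cases hy' : t + ε ≤ |h y|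
      · exact Or.inl ⟨hy', hyB⟩
      · refine Or.inr ⟨(abs_le.2 ⟨by linarith, by linarith⟩ : |(|h y| - t)| ≤ ε), hyB⟩
    have h2 : 2 * b * V ≤ volume P + b * V :=
      (hlow.trans (measure_mono h1)).trans ((measure_union_le _ _).trans (by gcongr))
    rw [mul_assoc, two_mul] at h2
    exact (ENNReal.add_le_add_iff_right hbV).1 h2
  have hN : b * V ≤ volume N := by
    have h1 : B ⊆ (A ∩ B ∪ S ∩ B) ∪ N := by
      intro y hyB
      by_cases hy : t < |h y|
      · exact Or.inl (Or.inl ⟨hy, hyB⟩)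
      · push Not at hy
        by_cases hy' : |h y| ≤ t - ε
        · exact Or.inr ⟨hy', hyB⟩
        · exact Or.inl (Or.inr ⟨(abs_le.2 ⟨by linarith, by linarith⟩ : |(|h y| - t)| ≤ ε), hyB⟩)
    have h2 : V ≤ (1 / 2 * V + b * V) + volume N :=
      (measure_mono h1).trans ((measure_union_le _ _).trans
        (add_le_add_left ((measure_union_le _ _).trans (add_le_add hup hstrip)) _))
    have h3 : (1 / 2 * V + b * V) + b * V ≤ V := by
      rw [← add_mul, ← add_mul]
      refine (mul_le_mul_left (a := V) (b := 1 / 2 + b + b) (c := 1) ?_).trans (one_mul V).le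
      calc (1 / 2 + b + b : ℝ≥0∞) ≤ 1 / 2 + 1 / 4 + 1 / 4 := by gcongr
        _ = 1 := by
          rw [add_assoc, ← ENNReal.add_div]
          norm_num
          have : (2 / 4 : ℝ≥0∞) = 2⁻¹ := by
            rw [show (4 : ℝ≥0∞) = 2 * 2 by norm_num, ENNReal.div_eq_inv_mul,
              ENNReal.mul_inv (by simp) (by simp), mul_assoc, ENNReal.inv_mul_cancel] <;> simp
          rw [this, ENNReal.inv_two_add_inv_two]
    exact (ENNReal.add_le_add_iff_left
      (ENNReal.add_ne_top.2 ⟨ENNReal.mul_ne_top (by simp) hVt, hbV⟩)).1 (h3.trans h2)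
  have hlower : (b * V) * (b * V) ≤
      ∫⁻ x in B, ∫⁻ y in B, ‖T (h x) - T (h y)‖ₑ := by
    calc (b * V) * (b * V) ≤ volume N * volume P := by gcongr
      _ = ∫⁻ _ in P, ∫⁻ _ in N, 1 := by simp
      _ = ∫⁻ x in P, ∫⁻ y in N, ‖T (h x) - T (h y)‖ₑ := by
        refine setLIntegral_congr_fun hPm fun x hx => ?_
        refine setLIntegral_congr_fun hNm fun y hy => ?_
        simp only [hT1 _ hx.1, hT0 _ hy.1]
        simp
      _ ≤ ∫⁻ x in B, ∫⁻ y in B, ‖T (h x) - T (h y)‖ₑ :=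
        lintegral_mono' (Measure.restrict_mono inter_subset_right le_rfl) fun x =>
          lintegral_mono' (Measure.restrict_mono inter_subset_right le_rfl) le_rfl
  have hupper := hf.poincare hq hT hTd x hρ
  have hIntg : ∫⁻ z in B, ‖deriv T (h z)‖ₑ * ‖q z‖ₑ ≤
      ENNReal.ofReal (L / ε) * ∫⁻ z in S ∩ B, ‖q z‖ₑ := by
    calc ∫⁻ z in B, ‖deriv T (h z)‖ₑ * ‖q z‖ₑ
        ≤ ∫⁻ z in B, S.indicator (fun z => ENNReal.ofReal (L / ε) * ‖q z‖ₑ) z := by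
          refine lintegral_mono fun z => ?_
          by_cases hz : z ∈ S
          · simp only [indicator_of_mem hz]
            gcongr
            rw [← ofReal_norm]
            exact ENNReal.ofReal_le_ofReal (hTd _)
          · have : deriv T (h z) = 0 := hTz _ (not_le.1 hz)
            simp [this]
      _ = ∫⁻ z in S ∩ B, ENNReal.ofReal (L / ε) * ‖q z‖ₑ := by
          rw [lintegral_indicator hSm, Measure.restrict_restrict hSm]
      _ = _ := by rw [lintegral_const_mul' _ _ ENNReal.ofReal_ne_top]
  set I := ∫⁻ z in S ∩ B, ‖q z‖ₑ
  have hρ0 : ENNReal.ofReal ρ ≠ 0 := by simpa using hρ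
  have main : (b * V) * (b * V) ≤
      2 ^ (n + 1) * ENNReal.ofReal ρ * V * (ENNReal.ofReal (L / ε) * I) :=
    hlower.trans (hupper.trans (by gcongr))
  have main2 : b ^ 2 * V ≤ 2 ^ (n + 1) * ENNReal.ofReal ρ * (ENNReal.ofReal (L / ε) * I) := by
    refine (ENNReal.mul_le_mul_iff_left hV0 hVt).1 ?_
    calc b ^ 2 * V * V = (b * V) * (b * V) := by ring
      _ ≤ _ := main
      _ = _ := by ring
  rw [ENNReal.div_le_iff hρ0 ENNReal.ofReal_ne_top]
  have hb2 : b ^ 2 ≠ 0 := pow_ne_zero _ hb0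
  have hb2t : b ^ 2 ≠ ⊤ := ENNReal.pow_ne_top hbt
  calc V = (b ^ 2)⁻¹ * (b ^ 2 * V) := by
        rw [← mul_assoc, ENNReal.inv_mul_cancel hb2 hb2t, one_mul]
    _ ≤ (b ^ 2)⁻¹ * (2 ^ (n + 1) * ENNReal.ofReal ρ * (ENNReal.ofReal (L / ε) * I)) := by
        gcongr
    _ = _ := by ring

theorem volume_ball_five_mul {n : ℕ} (x : Eu n) {r : ℝ} (hr : 0 < r) :
    volume (ball x (5 * r)) = 5 ^ n * volume (ball x r) := by
  rw [Measure.addHaar_ball_of_pos volume x hr,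
    Measure.addHaar_ball_of_pos volume x (by positivity : 0 < 5 * r), mul_pow,
    ENNReal.ofReal_mul (by positivity), finrank_euclideanSpace_fin,
    ENNReal.ofReal_pow (by positivity)]
  simp [mul_assoc]

theorem eventually_strip_le {n : ℕ} {h : Eu n → ℝ} (hh : Measurable h) {t : ℝ}
    (ht : ¬ 0 < volume {y | |h y| = t}) (x : Eu n) (ρ : ℝ) {c : ℝ≥0∞} (hc : c ≠ 0) :
    ∀ᶠ ε in 𝓝[>] (0 : ℝ), volume ({y | |(|h y| - t)| ≤ ε} ∩ ball x ρ) ≤ c := by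
  have hlim := tendsto_measure_biInter_gt (μ := volume)
    (s := fun ε : ℝ => {y | |(|h y| - t)| ≤ ε} ∩ ball x ρ) (a := 0)
    (fun ε _ => ((measurableSet_le (by fun_prop) (by fun_prop)).inter
      measurableSet_ball).nullMeasurableSet)
    (fun i j _ hij y hy => ⟨le_trans hy.1 hij, hy.2⟩)
    ⟨1, one_pos, ((measure_mono inter_subset_right).trans_lt measure_ball_lt_top).ne⟩
  have hz : volume (⋂ r > (0 : ℝ), {y | |(|h y| - t)| ≤ r} ∩ ball x ρ) = 0 := by
    refine measure_mono_null (fun y hy => ?_) (not_lt.1 ht |>.antisymm bot_le)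
    simp only [mem_iInter] at hy
    have : |(|h y| - t)| ≤ 0 := le_of_forall_gt_imp_ge_of_dense fun r hr => (hy r hr).1
    exact sub_eq_zero.1 (abs_nonpos_iff.1 this)
  rw [hz] at hlim
  exact (hlim.eventually_lt_const (pos_iff_ne_zero.2 hc)).mono fun _ h => h.le

/-- A boxing inequality: the points at which `{δ < |h|}` has non-negligible density are covered
by balls whose total perimeter is controlled by the `L¹` norm of the gradient of `h`. -/
theorem exists_boxing_constant (n : ℕ) {a : ℝ≥0∞} (ha0 : a ≠ 0) (ha : a ≤ 1 / 2) :
    ∃ K : ℝ≥0∞, K ≠ ⊤ ∧ ∀ (h : Eu n → ℝ) (q : Eu n → Eu n) (f : ℕ → Eu n → ℝ),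
      SmoothApprox h q f → Measurable h → Integrable q → ∀ δ : ℝ, 0 < δ →
      volume {y | δ / 2 < |h y|} < a * volume (ball (0 : Eu n) 1) →
      ∀ κ : ℝ≥0∞, κ ≠ 0 → ∃ (u : Set (Eu n)) (ρ : Eu n → ℝ), (∀ x ∈ u, 0 < ρ x ∧ ρ x ≤ 10) ∧
        {x | ∃ r > 0, a * volume (ball x r) < volume ({y | δ < |h y|} ∩ ball x r)} ⊆
          ⋃ x ∈ u, ball x (ρ x) ∧
        ∑' x : u, volume (ball (x : Eu n) (ρ x)) / ENNReal.ofReal (ρ x) ≤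
          K * ((∫⁻ x, ‖q x‖ₑ) / ENNReal.ofReal (δ / 2) + κ) := by
  obtain ⟨L, hL, hstep⟩ := exists_smooth_step
  have hat : a ≠ ⊤ := (ha.trans_lt (by simp)).ne
  set b : ℝ≥0∞ := a / 2 ^ (n + 1) with hb
  have hb0 : b ≠ 0 := ENNReal.div_ne_zero.2 ⟨ha0, by simp⟩
  have hb4 : b ≤ 1 / 4 := by
    rw [hb]
    have h2 : (2 : ℝ≥0∞) ≤ 2 ^ (n + 1) := by
      calc (2 : ℝ≥0∞) = 2 ^ 1 := by simp
        _ ≤ 2 ^ (n + 1) := pow_le_pow_right₀ (by simp) (by omega)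
    calc a / 2 ^ (n + 1) ≤ (1 / 2) / 2 := by gcongr
      _ = 1 / 4 := by
        rw [one_div, one_div, ENNReal.div_eq_inv_mul, ← ENNReal.mul_inv (by simp) (by simp)]
        norm_num
  have h2b : 2 * b * 2 ^ n = a := by
    rw [hb, mul_right_comm, ← pow_succ', ENNReal.mul_div_cancel (by simp) (by simp)]
  refine ⟨5 ^ n * (2 ^ (n + 1) * (b ^ 2)⁻¹ * ENNReal.ofReal (2 * L)), ?_, ?_⟩
  · exact ENNReal.mul_ne_top (by simp) (ENNReal.mul_ne_top (ENNReal.mul_ne_top (by simp)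
      (by simp [hb0])) ENNReal.ofReal_ne_top)
  intro h q f hf hh hq δ hδ hvol κ hκ
  set m₀ : Measure (Eu n) := volume.withDensity fun x => ‖q x‖ₑ with hm₀
  have : IsFiniteMeasure m₀ := isFiniteMeasure_withDensity hq.2.ne
  have habs : Measurable fun y => |h y| := by fun_prop
  set m : Measure ℝ := m₀.map fun y => |h y| with hm
  have : IsFiniteMeasure m := Measure.isFiniteMeasure_map _ _
  have hmuniv : m univ = ∫⁻ x, ‖q x‖ₑ := by
    rw [hm, Measure.map_apply habs MeasurableSet.univ, preimage_univ, hm₀,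
      withDensity_apply _ MeasurableSet.univ, Measure.restrict_univ]
  obtain ⟨t, ht, htS, hlev⟩ := exists_level (m := m)
    (Measure.countable_meas_level_set_pos (μ := (volume : Measure (Eu n))) habs)
    (show δ / 2 < δ by linarith) hκ
  rw [hmuniv, show δ - δ / 2 = δ / 2 by ring] at hlev
  have ht0 : 0 < t := (half_pos hδ).trans ht.1
  set bad := {x | ∃ r > 0, a * volume (ball x r) < volume ({y | δ < |h y|} ∩ ball x r)}
  have hbal : ∀ x, ∃ ρ : ℝ, x ∈ bad → 0 < ρ ∧ ρ ≤ 2 ∧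
      volume ({y | t < |h y|} ∩ ball x ρ) ≤ a * volume (ball x ρ) ∧
      a * volume (ball x ρ) ≤ 2 ^ n * volume ({y | t < |h y|} ∩ ball x ρ) := by
    intro x
    by_cases hx : x ∈ bad
    · obtain ⟨r, hr, hxr⟩ := hx
      obtain ⟨ρ, hρ⟩ := exists_balanced_radius (A := {y | t < |h y|}) (x := x) (a := a)
        ((measure_mono fun y hy => lt_trans ht.1 hy).trans_lt hvol)
        ⟨r, hr, hxr.trans_le (measure_mono
          (inter_subset_inter_left _ fun y hy => lt_trans ht.2 hy))⟩
      exact ⟨ρ, fun _ => hρ⟩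
    · exact ⟨0, fun h => absurd h hx⟩
  choose ρ hρ using hbal
  obtain ⟨u, hub, hdisj, hcov⟩ := Vitali.exists_disjoint_subfamily_covering_enlargement_ball
    bad id ρ 2 (fun x hx => (hρ x hx).2.1) 5 (by norm_num)
  refine ⟨u, fun x => 5 * ρ x, fun x hx => ?_, ?_, ?_⟩
  · obtain ⟨h1, h2, -⟩ := hρ x (hub hx)
    constructor <;> linarith
  · intro x hx
    obtain ⟨y, hy, hxy⟩ := hcov x hx
    exact mem_iUnion₂.2 ⟨y, hy, hxy (mem_ball_self (hρ x hx).1)⟩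
  set Q := (∫⁻ x, ‖q x‖ₑ) / ENNReal.ofReal (δ / 2) + κ
  have hfin : ∀ F : Finset u, ∑ x ∈ F, volume (ball (x : Eu n) (ρ x)) / ENNReal.ofReal (ρ x) ≤
      2 ^ (n + 1) * (b ^ 2)⁻¹ * ENNReal.ofReal (2 * L) * Q := by
    intro F
    have hev : ∀ᶠ ε in 𝓝[>] (0 : ℝ), ∀ x ∈ F,
        volume ({y | |(|h y| - t)| ≤ ε} ∩ ball (x : Eu n) (ρ x)) ≤
          b * volume (ball (x : Eu n) (ρ x)) := by
      rw [Filter.eventually_all_finset]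
      intro x _
      exact eventually_strip_le hh htS _ _
        (mul_ne_zero hb0 (measure_ball_pos volume _ (hρ x (hub x.2)).1).ne')
    obtain ⟨ε, ⟨⟨hstrip, hlevε⟩, hεt⟩, hε⟩ := (((hev.and hlev).and
      (mem_nhdsWithin_of_mem_nhds (Iio_mem_nhds ht0))).and self_mem_nhdsWithin).exists
    have hε : 0 < ε := hε
    have hεt : ε < t := hεt
    obtain ⟨T, hT, hT0, hT1, hTd, hTz⟩ := hstep t ε hε hεt
    set S : Set (Eu n) := {y | |(|h y| - t)| ≤ ε}
    have hSm : MeasurableSet S := measurableSet_le (by fun_prop) (by fun_prop)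
    set c := 2 ^ (n + 1) * (b ^ 2)⁻¹ * ENNReal.ofReal (L / ε)
    have hone : ∀ x ∈ F, volume (ball (x : Eu n) (ρ x)) / ENNReal.ofReal (ρ x) ≤
        c * ∫⁻ z in S ∩ ball (x : Eu n) (ρ x), ‖q z‖ₑ := by
      intro x hx
      obtain ⟨hr0, -, hr1, hr2⟩ := hρ x (hub x.2)
      refine hf.volume_div_radius_le hh hq hε hT hT0 hT1 hTd hTz hr0 hb0 hb4
        (hr1.trans (by gcongr)) ?_ (hstrip x hx)
      rw [← h2b, mul_right_comm, mul_comm _ ((2 : ℝ≥0∞) ^ n)] at hr2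
      exact (ENNReal.mul_le_mul_iff_right (by simp) (by simp)).1 hr2
    have hsum : ∑ x ∈ F, ∫⁻ z in S ∩ ball (x : Eu n) (ρ x), ‖q z‖ₑ ≤ m (closedBall t ε) := by
      have hpd : Set.PairwiseDisjoint (↑F) fun x : u => S ∩ ball (x : Eu n) (ρ x) := by
        intro x _ y _ hxy
        exact (hdisj x.2 y.2 (fun he => hxy (Subtype.ext he))).mono inter_subset_right
          inter_subset_right
      rw [← lintegral_biUnion_finset hpd fun x _ => hSm.inter measurableSet_ball, hm,
        Measure.map_apply habs measurableSet_closedBall, hm₀,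
        withDensity_apply _ (habs measurableSet_closedBall)]
      refine lintegral_mono_set (iUnion₂_subset fun x _ y hy => ?_)
      simpa [Real.dist_eq, S] using hy.1
    calc ∑ x ∈ F, volume (ball (x : Eu n) (ρ x)) / ENNReal.ofReal (ρ x)
        ≤ ∑ x ∈ F, c * ∫⁻ z in S ∩ ball (x : Eu n) (ρ x), ‖q z‖ₑ := Finset.sum_le_sum hone
      _ = c * ∑ x ∈ F, ∫⁻ z in S ∩ ball (x : Eu n) (ρ x), ‖q z‖ₑ := by rw [Finset.mul_sum]
      _ ≤ c * (ENNReal.ofReal (2 * ε) * Q) := by gcongr; exact hsum.trans hlevε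
      _ = 2 ^ (n + 1) * (b ^ 2)⁻¹ * (ENNReal.ofReal (L / ε) * ENNReal.ofReal (2 * ε)) * Q := by
        simp only [c]; ring
      _ = _ := by
        rw [← ENNReal.ofReal_mul (by positivity)]
        congr 3
        field_simp
  rw [ENNReal.tsum_eq_iSup_sum]
  refine iSup_le fun F => ?_
  calc ∑ x ∈ F, volume (ball (x : Eu n) (5 * ρ x)) / ENNReal.ofReal (5 * ρ x)
      ≤ ∑ x ∈ F, 5 ^ n * (volume (ball (x : Eu n) (ρ x)) / ENNReal.ofReal (ρ x)) := by
        refine Finset.sum_le_sum fun x _ => ?_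
        have hr0 := (hρ x (hub x.2)).1
        rw [volume_ball_five_mul _ hr0, mul_div_assoc]
        gcongr
        linarith
    _ = 5 ^ n * ∑ x ∈ F, volume (ball (x : Eu n) (ρ x)) / ENNReal.ofReal (ρ x) := by
        rw [Finset.mul_sum]
    _ ≤ 5 ^ n * (2 ^ (n + 1) * (b ^ 2)⁻¹ * ENNReal.ofReal (2 * L) * Q) := by
        gcongr; exact hfin F
    _ = _ := by ring

theorem exists_isTest_one_nhds {n : ℕ} {K V : Set (Eu n)} (hK : IsCompact K) (hV : IsOpen V)
    (hKV : K ⊆ V) :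
    ∃ η : Eu n → ℝ, IsTest V η ∧ (∀ x, η x ∈ Icc (0 : ℝ) 1) ∧
      ∃ W, IsOpen W ∧ K ⊆ W ∧ ∀ x ∈ W, η x = 1 := by
  obtain ⟨K', hK', hKK', hK'V⟩ := exists_compact_between hK hV hKV
  obtain ⟨f, hf1, hf0, hf⟩ := exists_contMDiffMap_one_nhds_of_subset_interior
    (n := (⊤ : ℕ∞)) (modelWithCornersSelf ℝ (Eu n)) hK.isClosed hKK'
  have hts : tsupport f ⊆ K' := closure_minimal (fun x hx => by
    by_contra h; exact hx (hf0 x h)) hK'.isClosed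
  obtain ⟨W, hKW, hWo, hW1⟩ : ∃ W, K ⊆ W ∧ IsOpen W ∧ ∀ x ∈ W, f x = 1 := by
    obtain ⟨W, hW, hKW, h⟩ := eventually_nhdsSet_iff_exists.1 hf1
    exact ⟨W, hKW, hW, h⟩
  exact ⟨f, ⟨f.contMDiff.contDiff, hK'.of_isClosed_subset (isClosed_tsupport _) hts,
    hts.trans hK'V⟩, hf, W, hWo, hKW, hW1⟩

/-- Bump functions adapted to a ball of radius `r`, with gradient of order `1 / r`. -/
theorem exists_ball_bump (n : ℕ) : ∃ L : ℝ, 0 < L ∧ ∀ (x : Eu n) (r : ℝ), 0 < r →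
    ∃ β : Eu n → ℝ, ContDiff ℝ (⊤ : ℕ∞) β ∧ (∀ y, 0 ≤ β y) ∧ (∀ y ∈ ball x r, β y = 1) ∧
      (∀ y ∉ closedBall x (2 * r), β y = 0) ∧
      ∀ y, ‖fderiv ℝ β y‖ ≤ (closedBall x (2 * r)).indicator (fun _ => L / r) y := by
  let b : ContDiffBump (0 : Eu n) := ⟨1, 2, one_pos, one_lt_two⟩
  have hbc : ContDiff ℝ (⊤ : ℕ∞) b := b.contDiff
  obtain ⟨C, hC⟩ := (b.hasCompactSupport.fderiv ℝ).exists_bound_of_continuous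
    (hbc.continuous_fderiv (by simp))
  refine ⟨max C 1, by positivity, fun x r hr => ⟨fun y => b (r⁻¹ • (y - x)), ?_, ?_, ?_, ?_, ?_⟩⟩
  · exact hbc.comp (by fun_prop)
  · exact fun y => b.nonneg
  · intro y hy
    refine b.one_of_mem_closedBall ?_
    rw [mem_closedBall_zero_iff, norm_smul, norm_inv, Real.norm_of_nonneg hr.le,
      ← div_eq_inv_mul, div_le_iff₀ hr, ← dist_eq_norm]
    simpa [b] using (mem_ball.1 hy).le
  · intro y hy
    refine b.zero_of_le_dist ?_
    rw [dist_zero_right, norm_smul, norm_inv, Real.norm_of_nonneg hr.le,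
      ← div_eq_inv_mul, le_div_iff₀ hr, ← dist_eq_norm]
    simpa [b] using (not_le.1 (fun h => hy (mem_closedBall.2 h))).le
  · intro y
    by_cases hy : y ∈ closedBall x (2 * r)
    · rw [indicator_of_mem hy]
      have h1 : HasFDerivAt (fun y : Eu n => r⁻¹ • (y - x))
          (r⁻¹ • ContinuousLinearMap.id ℝ (Eu n)) y :=
        ((hasFDerivAt_id y).sub_const x).const_smul (r⁻¹)
      have h2 := ((hbc.differentiable (by simp)) (r⁻¹ • (y - x))).hasFDerivAt.comp y h1
      have h3 : fderiv ℝ (fun y => b (r⁻¹ • (y - x))) y = _ := h2.fderiv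
      rw [h3, ContinuousLinearMap.comp_smul, ContinuousLinearMap.comp_id, norm_smul, norm_inv,
        Real.norm_of_nonneg hr.le, ← div_eq_inv_mul]
      gcongr
      exact (hC _).trans (le_max_left _ _)
    · rw [indicator_of_notMem hy]
      have : (fun y => b (r⁻¹ • (y - x))) =ᶠ[𝓝 y] fun _ => (0 : ℝ) := by
        filter_upwards [isClosed_closedBall.isOpen_compl.mem_nhds hy] with z hz
        refine b.zero_of_le_dist ?_
        rw [dist_zero_right, norm_smul, norm_inv, Real.norm_of_nonneg hr.le,
          ← div_eq_inv_mul, le_div_iff₀ hr, ← dist_eq_norm]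
        simpa [b] using (not_le.1 (fun h => hz (mem_closedBall.2 h))).le
      rw [this.fderiv_eq]
      simp

theorem volume_closedBall_two_mul {n : ℕ} (x : Eu n) {r : ℝ} (hr : 0 < r) :
    volume (closedBall x (2 * r)) = 2 ^ n * volume (ball x r) := by
  rw [Measure.addHaar_ball_of_pos volume x hr,
    Measure.addHaar_closedBall volume x (by positivity : 0 ≤ 2 * r), mul_pow,
    ENNReal.ofReal_mul (by positivity), finrank_euclideanSpace_fin,
    ENNReal.ofReal_pow (by positivity)]
  simp [mul_assoc]

/-- A cutoff `η` can be localized to a finite union of balls at a gradient cost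
controlled by the total perimeter of the balls. -/
theorem exists_localized_cutoff (n : ℕ) : ∃ L : ℝ, 0 < L ∧ ∀ (η : Eu n → ℝ) (L₁ : ℝ),
    ContDiff ℝ (⊤ : ℕ∞) η → (∀ x, η x ∈ Icc (0 : ℝ) 1) → (∀ x, ‖fderiv ℝ η x‖ ≤ L₁) →
    ∀ (F : Finset (Eu n)) (ρ : Eu n → ℝ), (∀ x ∈ F, 0 < ρ x ∧ ρ x ≤ 10) →
    ∃ θ : Eu n → ℝ, ContDiff ℝ (⊤ : ℕ∞) θ ∧ (∀ x, θ x ∈ Icc (0 : ℝ) 1) ∧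
      (∀ y ∈ ⋃ x ∈ F, ball x (ρ x), θ y = 1) ∧
      ∫⁻ y, ‖gradient (fun z => θ z * η z) y‖ₑ ≤
        ENNReal.ofReal (L + 10 * L₁) * 2 ^ n *
          ∑ x ∈ F, volume (ball x (ρ x)) / ENNReal.ofReal (ρ x) := by
  obtain ⟨L, hL, hS⟩ := exists_bound_deriv_smoothTransition
  obtain ⟨L₀, hL₀, hbump⟩ := exists_ball_bump n
  refine ⟨L * L₀, by positivity, fun η L₁ hη hη01 hηd F ρ hρ => ?_⟩
  have hL₁ : 0 ≤ L₁ := (norm_nonneg _).trans (hηd 0)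
  have : ∀ x, ∃ β : Eu n → ℝ, x ∈ F → ContDiff ℝ (⊤ : ℕ∞) β ∧ (∀ y, 0 ≤ β y) ∧
      (∀ y ∈ ball x (ρ x), β y = 1) ∧ (∀ y ∉ closedBall x (2 * ρ x), β y = 0) ∧
      ∀ y, ‖fderiv ℝ β y‖ ≤ (closedBall x (2 * ρ x)).indicator (fun _ => L₀ / ρ x) y := by
    intro x
    by_cases hx : x ∈ F
    · obtain ⟨β, hβ⟩ := hbump x (ρ x) (hρ x hx).1
      exact ⟨β, fun _ => hβ⟩
    · exact ⟨0, fun h => absurd h hx⟩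
  choose β hβ using this
  set w : Eu n → ℝ := fun y => ∑ x ∈ F, β x y with hw
  have hwc : ContDiff ℝ (⊤ : ℕ∞) w := ContDiff.sum fun x hx => (hβ x hx).1
  have hθc : ContDiff ℝ (⊤ : ℕ∞) fun y => Real.smoothTransition (w y) :=
    Real.smoothTransition.contDiff.comp hwc
  refine ⟨fun y => Real.smoothTransition (w y), hθc,
    fun y => ⟨Real.smoothTransition.nonneg _, Real.smoothTransition.le_one _⟩, ?_, ?_⟩
  · intro y hy
    obtain ⟨x, hx, hyx⟩ := mem_iUnion₂.1 hy
    refine Real.smoothTransition.one_of_one_le ?_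
    calc (1 : ℝ) = β x y := ((hβ x hx).2.2.1 y hyx).symm
      _ ≤ w y := Finset.single_le_sum (f := fun x => β x y) (fun z hz => (hβ z hz).2.1 y) hx
  have hpt : ∀ y, ‖gradient (fun z => Real.smoothTransition (w z) * η z) y‖ ≤
      ∑ x ∈ F, (closedBall x (2 * ρ x)).indicator (fun _ => (L * L₀ + 10 * L₁) / ρ x) y := by
    intro y
    have h1 : HasFDerivAt w (∑ x ∈ F, fderiv ℝ (β x) y) y :=
      HasFDerivAt.fun_sum fun x hx => ((hβ x hx).1.differentiable (by simp) y).hasFDerivAt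
    have h2 : HasDerivAt Real.smoothTransition (deriv Real.smoothTransition (w y)) (w y) :=
      ((Real.smoothTransition.contDiff (n := 1)).differentiable one_ne_zero _).hasDerivAt
    have h3 := (h2.comp_hasFDerivAt y h1).mul (hη.differentiable (by simp) y).hasFDerivAt
    have h4 : fderiv ℝ (fun z => Real.smoothTransition (w z) * η z) y = _ := h3.fderiv
    have hθ : Real.smoothTransition (w y) ≤
        ∑ x ∈ F, (closedBall x (2 * ρ x)).indicator (fun _ => (1 : ℝ)) y := by
      by_cases hy : ∃ x ∈ F, y ∈ closedBall x (2 * ρ x)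
      · obtain ⟨x, hx, hyx⟩ := hy
        calc Real.smoothTransition (w y) ≤ 1 := Real.smoothTransition.le_one _
          _ = (closedBall x (2 * ρ x)).indicator (fun _ => (1 : ℝ)) y := by
            rw [indicator_of_mem hyx]
          _ ≤ _ := Finset.single_le_sum
            (f := fun x => (closedBall x (2 * ρ x)).indicator (fun _ => (1 : ℝ)) y)
            (fun z _ => indicator_nonneg (fun _ _ => zero_le_one) _) hx
      · push Not at hy
        have : w y = 0 := Finset.sum_eq_zero fun x hx => (hβ x hx).2.2.2.1 y (hy x hx)
        rw [this, Real.smoothTransition.zero]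
        exact Finset.sum_nonneg fun z _ => indicator_nonneg (fun _ _ => zero_le_one) _
    rw [norm_gradient_eq, h4]
    refine (norm_add_le _ _).trans ?_
    rw [norm_smul, norm_smul, norm_smul]
    simp only [Function.comp_apply]
    rw [Real.norm_of_nonneg (Real.smoothTransition.nonneg _), Real.norm_of_nonneg (hη01 y).1]
    calc Real.smoothTransition (w y) * ‖fderiv ℝ η y‖ + η y *
          (‖deriv Real.smoothTransition (w y)‖ * ‖∑ x ∈ F, fderiv ℝ (β x) y‖)
        ≤ (∑ x ∈ F, (closedBall x (2 * ρ x)).indicator (fun _ => (1 : ℝ)) y) * L₁ +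
          1 * (L * ∑ x ∈ F, (closedBall x (2 * ρ x)).indicator (fun _ => L₀ / ρ x) y) := by
          refine add_le_add (mul_le_mul hθ (hηd y) (norm_nonneg _)
            (Finset.sum_nonneg fun z _ => indicator_nonneg (fun _ _ => zero_le_one) _)) ?_
          refine mul_le_mul (hη01 y).2 (mul_le_mul (hS _) ?_ (norm_nonneg _) hL.le)
            (by positivity) zero_le_one
          exact (norm_sum_le _ _).trans (Finset.sum_le_sum fun x hx => (hβ x hx).2.2.2.2 y)
      _ = ∑ x ∈ F, ((closedBall x (2 * ρ x)).indicator (fun _ => (1 : ℝ)) y * L₁ +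
            L * (closedBall x (2 * ρ x)).indicator (fun _ => L₀ / ρ x) y) := by
          rw [Finset.sum_add_distrib, Finset.sum_mul, Finset.mul_sum, one_mul]
      _ ≤ _ := by
          refine Finset.sum_le_sum fun x hx => ?_
          obtain ⟨hx0, hx10⟩ := hρ x hx
          by_cases hy : y ∈ closedBall x (2 * ρ x)
          · simp only [indicator_of_mem hy]
            rw [add_div, one_mul, mul_div_assoc, add_comm]
            gcongr
            rw [le_div_iff₀ hx0]
            nlinarith
          · simp [indicator_of_notMem hy]
  calc ∫⁻ y, ‖gradient (fun z => Real.smoothTransition (w z) * η z) y‖ₑ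
      ≤ ∫⁻ y, ∑ x ∈ F, (closedBall x (2 * ρ x)).indicator
          (fun _ => ENNReal.ofReal ((L * L₀ + 10 * L₁) / ρ x)) y := by
        refine lintegral_mono fun y => ?_
        rw [← ofReal_norm]
        refine (ENNReal.ofReal_le_ofReal (hpt y)).trans ?_
        rw [ENNReal.ofReal_sum_of_nonneg fun x hx => indicator_nonneg (fun _ _ => by
          have := (hρ x hx).1; positivity) _]
        refine Finset.sum_le_sum fun x _ => ?_
        by_cases hy : y ∈ closedBall x (2 * ρ x)
        · simp only [indicator_of_mem hy]; exact le_rfl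
        · simp [indicator_of_notMem hy]
    _ = ∑ x ∈ F, ENNReal.ofReal ((L * L₀ + 10 * L₁) / ρ x) * volume (closedBall x (2 * ρ x)) := by
        rw [lintegral_finsetSum _ fun x _ => measurable_const.indicator measurableSet_closedBall]
        refine Finset.sum_congr rfl fun x _ => ?_
        rw [lintegral_indicator_const measurableSet_closedBall]
    _ = _ := by
        rw [Finset.mul_sum]
        refine Finset.sum_congr rfl fun x hx => ?_
        rw [volume_closedBall_two_mul _ (hρ x hx).1, ENNReal.ofReal_div_of_pos (hρ x hx).1]
        simp only [div_eq_mul_inv]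
        ring

/-- `s` can be covered by balls of radius at most `10` and arbitrarily small total perimeter. -/
def NullContent {n : ℕ} (s : Set (Eu n)) : Prop :=
  ∀ ε : ℝ≥0∞, ε ≠ 0 → ∃ (u : Set (Eu n)) (ρ : Eu n → ℝ), (∀ x ∈ u, 0 < ρ x ∧ ρ x ≤ 10) ∧
    s ⊆ ⋃ x ∈ u, ball x (ρ x) ∧
    ∑' x : u, volume (ball (x : Eu n) (ρ x)) / ENNReal.ofReal (ρ x) ≤ ε

theorem IsTest.integrable {n : ℕ} {Ω : Set (Eu n)} {φ : Eu n → ℝ} (hφ : IsTest Ω φ)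
    (μ : Measure (Eu n)) [IsFiniteMeasureOnCompacts μ] : Integrable φ μ :=
  hφ.1.continuous.integrable_of_hasCompactSupport hφ.2.1

theorem measure_eq_zero_of_compact_nullContent {n : ℕ} {U : Set (Eu n)} (hU : IsOpen U)
    {σ : Eu n → Eu n} {C : ℝ} (hσ : ∀ᵐ x ∂(volume.restrict U), ‖σ x‖ ≤ C) {P N : Measure (Eu n)}
    [IsFiniteMeasure P] [IsFiniteMeasure N] (hrep : RepNegDiv U σ P N) {K : Set (Eu n)}
    (hK : IsCompact K) (hKU : K ⊆ U) (hcont : NullContent K) (hN : N K = 0) : P K = 0 := by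
  by_contra hPK
  set p : ℝ := P.real K
  have hp : 0 < p := ENNReal.toReal_pos hPK (measure_ne_top _ _)
  obtain ⟨V₀, hKV₀, hV₀, hNV₀⟩ := K.exists_isOpen_lt_of_lt (μ := N) (ENNReal.ofReal (p / 2))
    (by rw [hN]; simpa using hp)
  obtain ⟨η, hη, hη01, W, -, hKW, hW⟩ := exists_isTest_one_nhds hK (hV₀.inter hU)
    (subset_inter hKV₀ hKU)
  obtain ⟨L₁, hL₁⟩ := (hη.2.1.fderiv ℝ).exists_bound_of_continuous
    (hη.1.continuous_fderiv (by simp))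
  obtain ⟨L, hL, hloc⟩ := exists_localized_cutoff n
  set c : ℝ≥0∞ := ENNReal.ofReal C * (ENNReal.ofReal (L + 10 * L₁) * 2 ^ n) with hc
  have hct : c ≠ ⊤ := ENNReal.mul_ne_top ENNReal.ofReal_ne_top
    (ENNReal.mul_ne_top ENNReal.ofReal_ne_top (by simp))
  have hkey : ∀ ε : ℝ≥0∞, ε ≠ 0 → ENNReal.ofReal (p / 2) ≤ c * ε := by
    intro ε hε
    obtain ⟨u, ρ, hρ, hcov, hsum⟩ := hcont ε hε
    obtain ⟨F, hFu, hF, hKF⟩ := hK.elim_finite_subcover_image (fun x _ => isOpen_ball) hcov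
    obtain ⟨F, rfl⟩ := hF.exists_finset_coe
    obtain ⟨θ, hθ, hθ01, hθ1, hθI⟩ := hloc η L₁ hη.1 hη01 hL₁ F ρ fun x hx => hρ x (hFu hx)
    set ψ : Eu n → ℝ := fun z => θ z * η z with hψ
    have hts : tsupport ψ ⊆ tsupport η := tsupport_mul_subset_right
    have htest : IsTest U ψ := ⟨hθ.mul hη.1, hη.2.1.mul_left,
      hts.trans (hη.2.2.trans inter_subset_right)⟩
    have hψ0 : ∀ x, 0 ≤ ψ x := fun x => mul_nonneg (hθ01 x).1 (hη01 x).1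
    have hψP : p ≤ ∫ x, ψ x ∂P := by
      calc p = ∫ x in K, (1 : ℝ) ∂P := by simp [p]
        _ = ∫ x in K, ψ x ∂P := by
          refine setIntegral_congr_fun hK.measurableSet fun x hx => ?_
          simp [hψ, hθ1 x (hKF hx), hW x (hKW hx)]
        _ ≤ ∫ x, ψ x ∂P := setIntegral_le_integral (htest.integrable P) (ae_of_all _ hψ0)
    have hψN : ∫ x, ψ x ∂N ≤ p / 2 := by
      calc ∫ x, ψ x ∂N ≤ ∫ x, V₀.indicator (fun _ => (1 : ℝ)) x ∂N := by
            refine integral_mono (htest.integrable N)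
              ((integrable_const _).indicator hV₀.measurableSet) fun x => ?_
            by_cases hx : x ∈ V₀
            · simp only [indicator_of_mem hx]
              exact mul_le_one₀ (hθ01 x).2 (hη01 x).1 (hη01 x).2
            · have : η x = 0 := image_eq_zero_of_notMem_tsupport fun h => hx (hη.2.2 h).1
              simp [hψ, this, indicator_of_notMem hx]
        _ = N.real V₀ := by simp [integral_indicator hV₀.measurableSet]
        _ ≤ p / 2 := ENNReal.toReal_le_of_le_ofReal (by positivity) hNV₀.le
    have hI : p / 2 ≤ ∫ x in U, ⟪σ x, gradient ψ x⟫ := by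
      rw [hrep ψ htest]; linarith
    calc ENNReal.ofReal (p / 2) ≤ ENNReal.ofReal ‖∫ x in U, ⟪σ x, gradient ψ x⟫‖ :=
          ENNReal.ofReal_le_ofReal (hI.trans (le_abs_self _))
      _ ≤ ∫⁻ x in U, ‖⟪σ x, gradient ψ x⟫‖ₑ := by
          rw [ofReal_norm]; exact enorm_integral_le_lintegral_enorm _
      _ ≤ ∫⁻ x in U, ENNReal.ofReal C * ‖gradient ψ x‖ₑ := by
          refine lintegral_mono_ae ?_
          filter_upwards [hσ] with x hx
          rw [← ofReal_norm, ← ofReal_norm, ← ENNReal.ofReal_mul ((norm_nonneg _).trans hx)]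
          refine ENNReal.ofReal_le_ofReal ((norm_inner_le_norm _ _).trans ?_)
          gcongr
      _ = ENNReal.ofReal C * ∫⁻ x in U, ‖gradient ψ x‖ₑ := by
          rw [lintegral_const_mul' _ _ ENNReal.ofReal_ne_top]
      _ ≤ ENNReal.ofReal C * ∫⁻ x, ‖gradient ψ x‖ₑ := by
          gcongr; exact Measure.restrict_le_self
      _ ≤ ENNReal.ofReal C * (ENNReal.ofReal (L + 10 * L₁) * 2 ^ n *
          ∑ x ∈ F, volume (ball x (ρ x)) / ENNReal.ofReal (ρ x)) := by gcongr
      _ = c * ∑ x ∈ F, volume (ball x (ρ x)) / ENNReal.ofReal (ρ x) := by rw [hc]; ring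
      _ ≤ c * ε := by
          gcongr
          refine le_trans ?_ hsum
          rw [← Finset.tsum_subtype' F
            (fun x => volume (ball x (ρ x)) / ENNReal.ofReal (ρ x))]
          exact ENNReal.tsum_mono_subtype
            (fun x => volume (ball x (ρ x)) / ENNReal.ofReal (ρ x)) hFu
  have hlim : Tendsto (fun ε : ℝ≥0∞ => c * ε) (𝓝[≠] 0) (𝓝 (c * 0)) :=
    (ENNReal.continuous_const_mul hct).continuousWithinAt.tendsto
  have := ge_of_tendsto hlim (eventually_nhdsWithin_of_forall hkey)
  rw [mul_zero, nonpos_iff_eq_zero, ENNReal.ofReal_eq_zero] at this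
  linarith

theorem NullContent.exists_superset {n : ℕ} {s : Set (Eu n)} (hs : NullContent s) :
    ∃ G, MeasurableSet G ∧ s ⊆ G ∧ NullContent G := by
  choose! u ρ hρ hcov hsum using hs
  refine ⟨⋂ k : ℕ, ⋃ x ∈ u ((k : ℝ≥0∞) + 1)⁻¹, ball x (ρ ((k : ℝ≥0∞) + 1)⁻¹ x), ?_, ?_, ?_⟩
  · exact MeasurableSet.iInter fun k =>
      (isOpen_biUnion fun x _ => isOpen_ball).measurableSet
  · exact subset_iInter fun k => hcov _ (by simp)
  · intro ε hε
    obtain ⟨k, hk⟩ := ENNReal.exists_inv_nat_lt hε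
    have hk0 : ((k : ℝ≥0∞) + 1)⁻¹ ≠ 0 := by simp
    refine ⟨_, _, hρ _ hk0, iInter_subset _ k, (hsum _ hk0).trans (le_trans ?_ hk.le)⟩
    simp

theorem NullContent.mono {n : ℕ} {s t : Set (Eu n)} (ht : NullContent t) (hst : s ⊆ t) :
    NullContent s := fun ε hε => by
  obtain ⟨u, ρ, hρ, hcov, hsum⟩ := ht ε hε
  exact ⟨u, ρ, hρ, hst.trans hcov, hsum⟩

theorem RepNegDiv.neg {n : ℕ} {U : Set (Eu n)} {σ : Eu n → Eu n} {P N : Measure (Eu n)}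
    (h : RepNegDiv U σ P N) : RepNegDiv U (fun x => -σ x) N P := fun φ hφ => by
  simp only [inner_neg_left, integral_neg, h φ hφ, neg_sub]

theorem NullContent.measure_inter_eq_zero {n : ℕ} {s : Set (Eu n)} (hs : NullContent s)
    {U : Set (Eu n)} (hU : IsOpen U)
    {σ : Eu n → Eu n} {C : ℝ} (hσ : ∀ᵐ x ∂(volume.restrict U), ‖σ x‖ ≤ C) {P N : Measure (Eu n)}
    [IsFiniteMeasure P] [IsFiniteMeasure N] (hPN : P ⟂ₘ N) (hrep : RepNegDiv U σ P N) :
    P (s ∩ U) = 0 := by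
  obtain ⟨G, hGm, hsG, hG⟩ := hs.exists_superset
  obtain ⟨D, hDm, hPD, hND⟩ := hPN
  refine measure_mono_null (t := (G ∩ U ∩ Dᶜ) ∪ D) (fun x hx => ?_) ?_
  · by_cases hxD : x ∈ D
    · exact Or.inr hxD
    · exact Or.inl ⟨⟨hsG hx.1, hx.2⟩, hxD⟩
  refine measure_union_null ?_ hPD
  have hm : MeasurableSet (G ∩ U ∩ Dᶜ) := (hGm.inter hU.measurableSet).inter hDm.compl
  rw [hm.measure_eq_iSup_isCompact]
  simp only [ENNReal.iSup_eq_zero]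
  intro K hK hKc
  exact measure_eq_zero_of_compact_nullContent hU hσ hrep hKc
    (fun x hx => (hK hx).1.2) (hG.mono fun x hx => (hK hx).1.1)
    (measure_mono_null (fun x hx => (hK hx).2) hND)

/-- The standard bump functions with support shrinking to the origin. -/
def mollBump (n l : ℕ) : ContDiffBump (0 : Eu n) where
  rIn := 1 / (2 * ((l : ℝ) + 1))
  rOut := 1 / ((l : ℝ) + 1)
  rIn_pos := by positivity
  rIn_lt_rOut := by
    apply one_div_lt_one_div_of_lt <;> linarith [(l.cast_nonneg : (0 : ℝ) ≤ l)]

theorem tendsto_rOut_mollBump (n : ℕ) :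
    Tendsto (fun l => (mollBump n l).rOut) atTop (𝓝 0) :=
  tendsto_one_div_add_atTop_nhds_zero_nat

theorem rOut_mollBump_le (n l : ℕ) : (mollBump n l).rOut ≤ 2 * (mollBump n l).rIn := by
  have : (0 : ℝ) < (l : ℝ) + 1 := by positivity
  simp only [mollBump]
  apply le_of_eq
  field_simp

/-- Almost everywhere convergence together with a bound on the norms by the norm of the limit
implies convergence in `L¹`. -/
theorem tendsto_lintegral_enorm_sub_of_ae {α G : Type*} [MeasurableSpace α]
    [NormedAddCommGroup G] {μ : Measure α}
    {F : α → G} {f : ℕ → α → G} (hF : Integrable F μ) (hf : ∀ l, AEStronglyMeasurable (f l) μ)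
    (hle : ∀ l, ∫⁻ x, ‖f l x‖ₑ ∂μ ≤ ∫⁻ x, ‖F x‖ₑ ∂μ)
    (hlim : ∀ᵐ x ∂μ, Tendsto (fun l => f l x) atTop (𝓝 (F x))) :
    Tendsto (fun l => ∫⁻ x, ‖f l x - F x‖ₑ ∂μ) atTop (𝓝 0) := by
  set A := ∫⁻ x, ‖F x‖ₑ ∂μ with hA
  have hAt : A ≠ ⊤ := hF.2.ne
  set a : ℕ → ℝ≥0∞ := fun l => ∫⁻ x, ‖f l x - F x‖ₑ ∂μ
  have hale : ∀ l, a l ≤ A + A := fun l => by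
    calc a l ≤ ∫⁻ x, ‖f l x‖ₑ + ‖F x‖ₑ ∂μ := lintegral_mono fun x => enorm_sub_le
      _ = ∫⁻ x, ‖f l x‖ₑ ∂μ + A := lintegral_add_left' (hf l).enorm _
      _ ≤ A + A := by gcongr; exact hle l
  have hsub : ∀ l, ∫⁻ x, (‖f l x‖ₑ + ‖F x‖ₑ - ‖f l x - F x‖ₑ) ∂μ ≤ A + A - a l := fun l => by
    rw [lintegral_sub' (f := fun x => ‖f l x‖ₑ + ‖F x‖ₑ) (g := fun x => ‖f l x - F x‖ₑ)
      ((hf l).sub hF.1).enorm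
      ((hale l).trans_lt (by simp [lt_top_iff_ne_top, hAt])).ne
      (ae_of_all _ fun x => enorm_sub_le), lintegral_add_left' (hf l).enorm]
    exact tsub_le_tsub_right (add_le_add_left (hle l) _) _
  have hfatou : A + A ≤ liminf (fun l => A + A - a l) atTop := by
    calc A + A = ∫⁻ x, ‖F x‖ₑ + ‖F x‖ₑ ∂μ := (lintegral_add_left' hF.1.enorm _).symm
      _ = ∫⁻ x, liminf (fun l => ‖f l x‖ₑ + ‖F x‖ₑ - ‖f l x - F x‖ₑ) atTop ∂μ := by
        refine lintegral_congr_ae ?_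
        filter_upwards [hlim] with x hx
        have h1 : Tendsto (fun l => ‖f l x‖ₑ + ‖F x‖ₑ) atTop (𝓝 (‖F x‖ₑ + ‖F x‖ₑ)) :=
          hx.enorm.add tendsto_const_nhds
        have h2 : Tendsto (fun l => ‖f l x - F x‖ₑ) atTop (𝓝 0) := by
          simpa using (hx.sub_const (F x)).enorm
        have h3 := ENNReal.Tendsto.sub h1 h2 (Or.inr ENNReal.zero_ne_top)
        rw [tsub_zero] at h3
        exact h3.liminf_eq.symm
      _ ≤ liminf (fun l => ∫⁻ x, (‖f l x‖ₑ + ‖F x‖ₑ - ‖f l x - F x‖ₑ) ∂μ) atTop :=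
        lintegral_liminf_le' fun l =>
          (((hf l).enorm.add hF.1.enorm).sub ((hf l).sub hF.1).enorm)
      _ ≤ _ := liminf_le_liminf (Eventually.of_forall hsub)
  by_cases hA0 : A = 0
  · have : a = fun _ => 0 := funext fun l => le_antisymm (by simpa [hA0] using hale l) bot_le
    rw [this]; exact tendsto_const_nhds
  rw [ENNReal.tendsto_nhds_zero]
  intro ε hε
  have hlt : A + A - ε < liminf (fun l => A + A - a l) atTop :=
    (ENNReal.sub_lt_self (by simp [hAt]) (by simp [hA0]) hε.ne').trans_le hfatou
  filter_upwards [eventually_lt_of_lt_liminf hlt] with l hl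
  by_contra! h
  exact absurd hl (not_lt.2 (tsub_le_tsub_left h.le _))

section Mollify

variable {n : ℕ} {G : Type*} [NormedAddCommGroup G] [NormedSpace ℝ G]

/-- The standard mollifications of a function. -/
def mollify (l : ℕ) (F : Eu n → G) : Eu n → G :=
  convolution ((mollBump n l).normed volume) F (ContinuousLinearMap.lsmul ℝ ℝ) volume

theorem contDiff_mollify {F : Eu n → G} (hF : LocallyIntegrable F) (l : ℕ) :
    ContDiff ℝ (⊤ : ℕ∞) (mollify l F) :=
  HasCompactSupport.contDiff_convolution_left _ (mollBump n l).hasCompactSupport_normed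
    (mollBump n l).contDiff_normed hF

theorem mollify_eq (l : ℕ) (F : Eu n → G) (x : Eu n) :
    mollify l F x = ∫ t, (mollBump n l).normed volume (x - t) • F t := by
  simp only [mollify, convolution_eq_swap, ContinuousLinearMap.lsmul_apply]

theorem lintegral_enorm_normed_mollBump (n l : ℕ) :
    ∫⁻ t, ‖(mollBump n l).normed (volume : Measure (Eu n)) t‖ₑ = 1 := by
  have h := ofReal_integral_eq_lintegral_ofReal
    ((mollBump n l).integrable_normed (μ := volume))
    (ae_of_all _ fun x => (mollBump n l).nonneg_normed x)
  rw [(mollBump n l).integral_normed, ENNReal.ofReal_one] at h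
  rw [h]
  refine lintegral_congr fun t => ?_
  rw [← ofReal_norm, Real.norm_of_nonneg ((mollBump n l).nonneg_normed t)]

theorem lintegral_enorm_mollify_le {F : Eu n → G} (hF : AEStronglyMeasurable F volume) (l : ℕ) :
    ∫⁻ x, ‖mollify l F x‖ₑ ≤ ∫⁻ x, ‖F x‖ₑ := by
  set k := (mollBump n l).normed (volume : Measure (Eu n))
  have hk : AEStronglyMeasurable k volume :=
    (mollBump n l).continuous_normed.aestronglyMeasurable
  calc ∫⁻ x, ‖mollify l F x‖ₑ ≤ ∫⁻ x, ∫⁻ t, ‖k t • F (x - t)‖ₑ :=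
        lintegral_mono fun x => enorm_integral_le_lintegral_enorm _
    _ = ∫⁻ t, ∫⁻ x, ‖k t • F (x - t)‖ₑ :=
        lintegral_lintegral_swap
          (hk.convolution_integrand (ContinuousLinearMap.lsmul ℝ ℝ) hF).enorm
    _ = ∫⁻ t, ‖k t‖ₑ * ∫⁻ x, ‖F x‖ₑ := by
        refine lintegral_congr fun t => ?_
        simp only [enorm_smul]
        rw [lintegral_const_mul' _ _ enorm_ne_top,
          lintegral_sub_right_eq_self (fun x => ‖F x‖ₑ) t]
    _ = ∫⁻ x, ‖F x‖ₑ := by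
        rw [lintegral_mul_const'' _ hk.enorm, lintegral_enorm_normed_mollBump, one_mul]

theorem ae_tendsto_mollify [CompleteSpace G] {F : Eu n → G} (hF : LocallyIntegrable F) :
    ∀ᵐ x, Tendsto (fun l => mollify l F x) atTop (𝓝 (F x)) :=
  ContDiffBump.ae_convolution_tendsto_right_of_locallyIntegrable (tendsto_rOut_mollBump n)
    (Eventually.of_forall (rOut_mollBump_le n)) hF

theorem tendsto_lintegral_enorm_mollify_sub [CompleteSpace G] {F : Eu n → G}
    (hF : Integrable F) :
    Tendsto (fun l => ∫⁻ x, ‖mollify l F x - F x‖ₑ) atTop (𝓝 0) :=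
  tendsto_lintegral_enorm_sub_of_ae hF
    (fun l => (contDiff_mollify hF.locallyIntegrable l).continuous.aestronglyMeasurable)
    (lintegral_enorm_mollify_le hF.1) (ae_tendsto_mollify hF.locallyIntegrable)

end Mollify

theorem abs_mollify_le {n : ℕ} {f : Eu n → ℝ} {M : ℝ} (hM : ∀ x, |f x| ≤ M) (l : ℕ) (x : Eu n) :
    |mollify l f x| ≤ M := by
  have hk := (mollBump n l).integrable_normed (μ := (volume : Measure (Eu n)))
  calc |mollify l f x| ≤ ∫ t, (mollBump n l).normed volume t * M := by
        rw [← Real.norm_eq_abs, mollify, convolution_def]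
        refine norm_integral_le_of_norm_le (hk.mul_const M) (ae_of_all _ fun t => ?_)
        rw [ContinuousLinearMap.lsmul_apply, norm_smul,
          Real.norm_of_nonneg ((mollBump n l).nonneg_normed t)]
        exact mul_le_mul_of_nonneg_left (hM _) ((mollBump n l).nonneg_normed t)
    _ = M := by rw [integral_mul_const, (mollBump n l).integral_normed, one_mul]

/-- Mollification commutes with weak differentiation. -/
theorem gradient_mollify {n : ℕ} {f : Eu n → ℝ} {g : Eu n → Eu n} (hf : LocallyIntegrable f)
    (hfg : ∀ φ : Eu n → ℝ, IsTest univ φ → ∫ x, f x • gradient φ x = - ∫ x, φ x • g x)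
    (l : ℕ) (x : Eu n) : gradient (mollify l f) x = mollify l g x := by
  set k := (mollBump n l).normed (volume : Measure (Eu n)) with hk
  have hkc : ContDiff ℝ (⊤ : ℕ∞) k := (mollBump n l).contDiff_normed
  have hks : HasCompactSupport k := (mollBump n l).hasCompactSupport_normed
  have hd : HasFDerivAt (mollify l f) _ x := hks.hasFDerivAt_convolution_left
    (ContinuousLinearMap.lsmul ℝ ℝ) (hkc.of_le (by simp)) hf x
  set φ : Eu n → ℝ := fun t => k (x - t) with hφ
  have hφg : ∀ t, gradient φ t = - gradient k (x - t) := by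
    intro t
    have h1 : HasFDerivAt (fun t : Eu n => x - t) (-ContinuousLinearMap.id ℝ (Eu n)) t :=
      (hasFDerivAt_id t).const_sub x
    have h2 := (hkc.differentiable (by simp) (x - t)).hasFDerivAt.comp t h1
    have h3 : fderiv ℝ φ t = _ := h2.fderiv
    simp only [gradient]
    rw [h3]
    simp
  have htest : IsTest univ φ :=
    ⟨hkc.comp (by fun_prop), hks.comp_homeomorph (Homeomorph.subLeft x), subset_univ _⟩
  have key := hfg φ htest
  simp only [hφg, smul_neg, integral_neg, neg_inj] at key
  let J : (Eu n →L[ℝ] ℝ) →ₗᵢ[ℝ] Eu n :=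
    ⟨⟨⟨(InnerProductSpace.toDual ℝ (Eu n)).symm, map_add _⟩, fun c ℓ => by simp⟩, fun ℓ => by simp⟩
  rw [mollify_eq, ← key, gradient, hd.fderiv, convolution_eq_swap]
  refine (J.integral_comp_comm _).symm.trans ?_
  refine integral_congr_ae (ae_of_all _ fun t => ?_)
  have : ((ContinuousLinearMap.lsmul ℝ ℝ : ℝ →L[ℝ] ℝ →L[ℝ] ℝ).precompL (Eu n))
      (fderiv ℝ k (x - t)) (f t) = f t • fderiv ℝ k (x - t) := by
    ext v
    simp [mul_comm]
  simp only [this]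
  simp [gradient, J]

theorem smoothApprox_mollify {n : ℕ} {f : Eu n → ℝ} {g : Eu n → Eu n} (hf : Integrable f)
    (hg : Integrable g)
    (hfg : ∀ φ : Eu n → ℝ, IsTest univ φ → ∫ x, f x • gradient φ x = - ∫ x, φ x • g x) :
    SmoothApprox f g fun l => mollify l f := by
  refine ⟨fun l => (contDiff_mollify hf.locallyIntegrable l).of_le (by simp),
    ae_tendsto_mollify hf.locallyIntegrable, ?_⟩
  simp only [gradient_mollify hf.locallyIntegrable hfg]
  exact tendsto_lintegral_enorm_mollify_sub hg

theorem DensityZeroAt.mono {n : ℕ} {A B : Set (Eu n)} {x : Eu n} (hB : DensityZeroAt B x)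
    (hAB : A ⊆ B) : DensityZeroAt A x :=
  tendsto_of_tendsto_of_tendsto_of_le_of_le tendsto_const_nhds hB (fun _ => bot_le)
    fun r => by dsimp only; gcongr

theorem not_densityZeroAt_univ {n : ℕ} (x : Eu n) : ¬ DensityZeroAt univ x := by
  intro h
  have : Tendsto (fun r : ℝ => volume (univ ∩ ball x r) / volume (ball x r)) (𝓝[>] 0) (𝓝 1) := by
    refine tendsto_const_nhds.congr' ?_
    filter_upwards [self_mem_nhdsWithin] with r hr
    rw [univ_inter, ENNReal.div_self (measure_ball_pos volume x hr).ne' measure_ball_lt_top.ne]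
  exact zero_ne_one (tendsto_nhds_unique h this)

theorem DensityZeroAt.union {n : ℕ} {A B : Set (Eu n)} {x : Eu n} (hA : DensityZeroAt A x)
    (hB : DensityZeroAt B x) : DensityZeroAt (A ∪ B) x := by
  have h := hA.add hB
  rw [add_zero] at h
  refine tendsto_of_tendsto_of_tendsto_of_le_of_le tendsto_const_nhds h (fun _ => bot_le)
    fun r => ?_
  dsimp only
  rw [← ENNReal.add_div, union_inter_distrib_right]
  gcongr
  exact measure_union_le _ _

/-- `c` is the approximate limit of `f` at `x`. -/
def ApproxLim {n : ℕ} (f : Eu n → ℝ) (x : Eu n) (c : ℝ) : Prop :=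
  ∀ δ : ℝ, 0 < δ → DensityZeroAt {y | δ < |f y - c|} x

theorem ApproxLim.upperRep_eq {n : ℕ} {f : Eu n → ℝ} {x : Eu n} {c : ℝ} (h : ApproxLim f x c) :
    upperRep f x = c := by
  have hIoi : Ioi c ⊆ {t : ℝ | DensityZeroAt {y | t < f y} x} := fun t ht => by
    have ht : c < t := ht
    refine (h ((t - c) / 2) (by linarith)).mono fun y hy => ?_
    have hy : t < f y := hy
    exact lt_of_lt_of_le (by linarith) (le_abs_self (f y - c))
  have hIci : {t : ℝ | DensityZeroAt {y | t < f y} x} ⊆ Ici c := fun t ht => by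
    by_contra htc
    have htc : t < c := not_le.1 htc
    refine not_densityZeroAt_univ x ((DensityZeroAt.union ht (h ((c - t) / 2)
      (by linarith))).mono fun y _ => ?_)
    by_cases hy : t < f y
    · exact Or.inl hy
    · refine Or.inr (lt_of_lt_of_le ?_ (neg_le_abs (f y - c)) : (c - t) / 2 < |f y - c|)
      linarith
  refine le_antisymm ?_ (le_csInf (nonempty_Ioi.mono hIoi) fun t ht => hIci ht)
  refine le_of_forall_gt_imp_ge_of_dense fun t ht => csInf_le ⟨c, fun s hs => hIci hs⟩ (hIoi ht)

theorem ApproxLim.tendsto_mollify {n : ℕ} {f : Eu n → ℝ} {x : Eu n} {c M : ℝ}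
    (h : ApproxLim f x c) (hf : Measurable f) (hM : ∀ y, |f y| ≤ M) :
    Tendsto (fun l => mollify l f x) atTop (𝓝 c) := by
  rw [Metric.tendsto_nhds]
  intro ε hε
  set δ := ε / 2 with hδ
  have hδ0 : 0 < δ := half_pos hε
  set A : Set (Eu n) := {y | δ < |f y - c|}
  have hAm : MeasurableSet A := measurableSet_lt (by fun_prop) (by fun_prop)
  have hM0 : 0 ≤ M := (abs_nonneg _).trans (hM 0)
  set M' := M + |c| with hM'
  have hM'0 : 0 ≤ M' := by positivity
  have hr : Tendsto (fun l => (mollBump n l).rOut) atTop (𝓝[>] 0) :=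
    tendsto_nhdsWithin_iff.2 ⟨tendsto_rOut_mollBump n,
      Eventually.of_forall fun l => (mollBump n l).rOut_pos⟩
  have hlim : Tendsto (fun l => M' * 2 ^ n * (volume (A ∩ ball x (mollBump n l).rOut) /
      volume (ball x (mollBump n l).rOut)).toReal) atTop (𝓝 (M' * 2 ^ n * 0)) :=
    (((ENNReal.tendsto_toReal ENNReal.zero_ne_top).comp ((h δ hδ0).comp hr))).const_mul _
  rw [mul_zero] at hlim
  filter_upwards [hlim.eventually_lt_const hδ0] with l hl
  set k := (mollBump n l).normed (volume : Measure (Eu n)) with hk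
  set R := (mollBump n l).rOut with hR
  have hR0 : 0 < R := (mollBump n l).rOut_pos
  have hkx : Integrable fun t => k (x - t) :=
    ((mollBump n l).integrable_normed (μ := volume)).comp_sub_left x
  have hk1 : ∫ t, k (x - t) = 1 := by
    rw [integral_sub_left_eq_self k volume x]; exact (mollBump n l).integral_normed
  have hk0 : ∀ t, 0 ≤ k t := (mollBump n l).nonneg_normed
  have hV : volume.real (ball x R) ≠ 0 := (ENNReal.toReal_pos
    (measure_ball_pos volume x hR0).ne' measure_ball_lt_top.ne).ne'
  have hkb : ∀ t, k (x - t) ≤ (ball x R).indicator (fun _ => 2 ^ n / volume.real (ball x R)) t := by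
    intro t
    by_cases ht : t ∈ ball x R
    · rw [indicator_of_mem ht]
      refine ((mollBump n l).normed_le_div_measure_closedBall_rOut volume 2
        (rOut_mollBump_le n l) (x - t)).trans ?_
      rw [finrank_euclideanSpace_fin]
      have : volume.real (ball x R) ≤ volume.real (closedBall (0 : Eu n) R) := by
        have h1 : volume.real (ball x R) = volume.real (ball (0 : Eu n) R) := by
          simp only [Measure.real, Measure.addHaar_ball_center volume x R]
        rw [h1]
        exact measureReal_mono ball_subset_closedBall measure_closedBall_lt_top.ne
      gcongr
    · rw [indicator_of_notMem ht]
      refine le_of_eq (Function.notMem_support.1 fun h => ht ?_)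
      rw [hk, (mollBump n l).support_normed_eq, mem_ball_zero_iff, ← dist_eq_norm] at h
      exact mem_ball'.2 h
  have hfk : Integrable fun t => k (x - t) * f t :=
    hkx.mul_bdd (c := M) hf.aestronglyMeasurable (ae_of_all _ hM)
  have heq : mollify l f x - c = ∫ t, k (x - t) * (f t - c) := by
    simp only [mul_sub]
    rw [integral_sub hfk (hkx.mul_const c), integral_mul_const, hk1, one_mul, mollify_eq]
    simp only [smul_eq_mul, hk]
  rw [Real.dist_eq, heq]
  have hAB : MeasurableSet (A ∩ ball x R) := hAm.inter measurableSet_ball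
  have hind : Integrable ((A ∩ ball x R).indicator
      fun _ : Eu n => M' * (2 ^ n / volume.real (ball x R))) :=
    (integrable_indicator_iff hAB).2 (integrableOn_const
      ((measure_mono inter_subset_right).trans_lt measure_ball_lt_top).ne)
  calc |∫ t, k (x - t) * (f t - c)|
      ≤ ∫ t, (k (x - t) * δ + (A ∩ ball x R).indicator
          (fun _ => M' * (2 ^ n / volume.real (ball x R))) t) := by
        rw [← Real.norm_eq_abs]
        refine norm_integral_le_of_norm_le ((hkx.mul_const δ).add hind) (ae_of_all _ fun t => ?_)
        rw [norm_mul, Real.norm_of_nonneg (hk0 _), Real.norm_eq_abs]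
        by_cases hA : t ∈ A
        · have h1 : |f t - c| ≤ M' := (abs_sub _ _).trans (by rw [hM']; gcongr; exact hM t)
          have h2 := hkb t
          have h3 : k (x - t) * |f t - c| ≤ (A ∩ ball x R).indicator
              (fun _ => M' * (2 ^ n / volume.real (ball x R))) t := by
            by_cases ht : t ∈ ball x R
            · rw [indicator_of_mem ht] at h2
              rw [indicator_of_mem (show t ∈ A ∩ ball x R from ⟨hA, ht⟩), mul_comm]
              exact mul_le_mul h1 h2 (hk0 _) hM'0
            · rw [indicator_of_notMem ht] at h2
              rw [indicator_of_notMem fun h => ht h.2, le_antisymm h2 (hk0 _), zero_mul]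
          have h4 : 0 ≤ k (x - t) * δ := mul_nonneg (hk0 _) hδ0.le
          linarith
        · rw [indicator_of_notMem fun h => hA h.1, add_zero]
          exact mul_le_mul_of_nonneg_left (not_lt.1 hA) (hk0 _)
    _ = δ + M' * 2 ^ n * (volume (A ∩ ball x R) / volume (ball x R)).toReal := by
        rw [integral_add (hkx.mul_const δ) hind, integral_mul_const, hk1, one_mul,
          integral_indicator hAB, setIntegral_const, ENNReal.toReal_div, smul_eq_mul]
        simp only [Measure.real]
        ring
    _ < ε := by rw [hδ] at hl ⊢; linarith

theorem nullContent_oscillation {n : ℕ} {f : Eu n → ℝ} {g : Eu n → Eu n} (hfm : Measurable f)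
    (hf : Integrable f) (hg : Integrable g)
    (hfg : ∀ φ : Eu n → ℝ, IsTest univ φ → ∫ x, f x • gradient φ x = - ∫ x, φ x • g x)
    {a : ℝ≥0∞} (ha0 : a ≠ 0) (ha : a ≤ 1 / 2) {δ : ℝ} (hδ : 0 < δ) :
    NullContent {x | ∀ c : ℝ, ∃ᶠ r in 𝓝[>] (0 : ℝ),
      a * volume (ball x r) < volume ({y | 2 * δ < |f y - c|} ∩ ball x r)} := by
  intro ε hε
  obtain ⟨K, hK, hbox⟩ := exists_boxing_constant n ha0 ha
  have hD : ENNReal.ofReal (δ / 2) ≠ 0 := by simpa using hδ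
  have hfc := fun l => contDiff_mollify hf.locallyIntegrable l
  have hq := tendsto_lintegral_enorm_mollify_sub hg
  have hh := tendsto_lintegral_enorm_mollify_sub hf
  have hκ : Tendsto (fun k : ℕ => ((k : ℝ≥0∞) + 1)⁻¹) atTop (𝓝 0) := by
    refine tendsto_of_tendsto_of_tendsto_of_le_of_le tendsto_const_nhds
      ENNReal.tendsto_inv_nat_nhds_zero (fun _ => bot_le) fun k => ?_
    exact ENNReal.inv_le_inv.2 le_self_add
  have hlim : Tendsto (fun k => K * ((∫⁻ x, ‖mollify k g x - g x‖ₑ) / ENNReal.ofReal (δ / 2) +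
      ((k : ℝ≥0∞) + 1)⁻¹)) atTop (𝓝 0) := by
    have h1 := (ENNReal.Tendsto.div_const hq (Or.inr hD)).add hκ
    rw [ENNReal.zero_div, add_zero] at h1
    simpa using ENNReal.Tendsto.const_mul h1 (Or.inr hK)
  have hvol : Tendsto (fun k => (∫⁻ x, ‖mollify k f x - f x‖ₑ) / ENNReal.ofReal (δ / 2)) atTop
      (𝓝 0) := by
    simpa using ENNReal.Tendsto.div_const hh (Or.inr hD)
  have hpos : 0 < a * volume (ball (0 : Eu n) 1) :=
    ENNReal.mul_pos ha0 (measure_ball_pos _ _ one_pos).ne'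
  obtain ⟨k, hk1, hk2⟩ := ((hlim.eventually_lt_const (pos_iff_ne_zero.2 hε)).and
    (hvol.eventually_lt_const hpos)).exists
  have happ := (smoothApprox_mollify hf hg hfg).sub ((hfc k).of_le (by simp) : ContDiff ℝ 1 _)
  simp only [gradient_mollify hf.locallyIntegrable hfg] at happ
  have hhm : Measurable fun x => f x - mollify k f x := hfm.sub (hfc k).continuous.measurable
  have hmg : AEStronglyMeasurable (mollify k g) volume :=
    (contDiff_mollify hg.locallyIntegrable k).continuous.aestronglyMeasurable
  have hqi : Integrable fun x => g x - mollify k g x := by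
    refine hg.sub ⟨hmg, lt_of_le_of_lt (lintegral_enorm_mollify_le hg.1 k) hg.2⟩
  obtain ⟨u, ρ, hρ, hcov, hsum⟩ := hbox _ _ _ happ hhm hqi δ hδ (by
    refine lt_of_le_of_lt ?_ hk2
    refine le_trans (measure_mono fun y hy => ?_) (meas_ge_le_lintegral_div
      ((hfc k).continuous.measurable.sub hfm).enorm.aemeasurable hD ENNReal.ofReal_ne_top)
    have hy : δ / 2 < |f y - mollify k f y| := hy
    rw [mem_ofPred_eq, Pi.sub_apply, Real.enorm_eq_ofReal_abs, abs_sub_comm]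
    exact ENNReal.ofReal_le_ofReal hy.le) ((k : ℝ≥0∞) + 1)⁻¹ (by simp)
  refine ⟨u, ρ, hρ, fun x hx => hcov ?_, hsum.trans ?_⟩
  · have hcont : ∀ᶠ r in 𝓝[>] (0 : ℝ), ∀ y ∈ ball x r, |mollify k f y - mollify k f x| < δ := by
      obtain ⟨r₀, hr₀, hb⟩ := Metric.continuous_iff.1 (hfc k).continuous x δ hδ
      filter_upwards [Ioo_mem_nhdsGT hr₀] with r hr y hy
      exact hb y (lt_trans hy hr.2)
    obtain ⟨r, hr, hr1, hr2⟩ := ((hx (mollify k f x)).and_eventually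
      (hcont.and self_mem_nhdsWithin)).exists
    refine ⟨r, hr2, hr.trans_le (measure_mono ?_)⟩
    rintro y ⟨hy1, hy2⟩
    refine ⟨?_, hy2⟩
    have hy1 : 2 * δ < |f y - mollify k f x| := hy1
    have h1 := hr1 y hy2
    have h2 := abs_sub_le (f y) (mollify k f y) (mollify k f x)
    show δ < |f y - mollify k f y|
    linarith
  · simp only [← enorm_sub_rev (mollify k g _)] at hk1 ⊢
    exact hk1.le

theorem exists_approxLim {n : ℕ} {f : Eu n → ℝ} {x : Eu n}
    (h : ∀ j : ℕ, ∃ c : ℝ, ∀ᶠ r in 𝓝[>] (0 : ℝ),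
      volume ({y | 2 * (1 / ((j : ℝ) + 1)) < |f y - c|} ∩ ball x r) ≤
        ((j : ℝ≥0∞) + 3)⁻¹ * volume (ball x r)) : ∃ c, ApproxLim f x c := by
  choose c hc using h
  have hlt : ∀ i j : ℕ, ((i : ℝ≥0∞) + 3)⁻¹ + ((j : ℝ≥0∞) + 3)⁻¹ < 1 := fun i j => by
    have h3 : ∀ i : ℕ, ((i : ℝ≥0∞) + 3)⁻¹ ≤ 3⁻¹ := fun i => ENNReal.inv_le_inv.2 le_add_self
    have h2 : ∀ i : ℕ, ((i : ℝ≥0∞) + 3)⁻¹ < 2⁻¹ := fun i =>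
      (h3 i).trans_lt (ENNReal.inv_lt_inv.2 (by norm_num))
    exact (ENNReal.add_lt_add (h2 i) (h2 j)).trans_eq ENNReal.inv_two_add_inv_two
  have hclose : ∀ i j : ℕ, |c i - c j| ≤ 2 * (1 / ((i : ℝ) + 1)) + 2 * (1 / ((j : ℝ) + 1)) := by
    intro i j
    by_contra! hcon
    obtain ⟨r, hi, hj, hr⟩ := ((hc i).and ((hc j).and self_mem_nhdsWithin)).exists
    have hr : 0 < r := hr
    have hcov : ball x r ⊆ ({y | 2 * (1 / ((i : ℝ) + 1)) < |f y - c i|} ∩ ball x r) ∪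
        ({y | 2 * (1 / ((j : ℝ) + 1)) < |f y - c j|} ∩ ball x r) := by
      intro y hy
      by_contra! hy'
      simp only [mem_union, mem_inter_iff, mem_ofPred_eq, hy, and_true, not_or, not_lt] at hy'
      have := abs_sub_le (c i) (f y) (c j)
      rw [abs_sub_comm (c i) (f y)] at this
      linarith [hy'.1, hy'.2]
    have hle := ((measure_mono hcov).trans (measure_union_le _ _)).trans (add_le_add hi hj)
    rw [← add_mul] at hle
    have hlt' := ENNReal.mul_lt_mul_left (measure_ball_pos volume x hr).ne'
      measure_ball_lt_top.ne (hlt i j)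
    rw [one_mul] at hlt'
    exact absurd hle (not_le.2 hlt')
  have hb0 : Tendsto (fun N : ℕ => 4 * (1 / ((N : ℝ) + 1))) atTop (𝓝 0) := by
    simpa using (tendsto_one_div_add_atTop_nhds_zero_nat (𝕜 := ℝ)).const_mul 4
  have hanti : ∀ {i N : ℕ}, N ≤ i → 1 / ((i : ℝ) + 1) ≤ 1 / ((N : ℝ) + 1) := fun h =>
    one_div_le_one_div_of_le (by positivity) (by gcongr)
  have hcau : CauchySeq c := cauchySeq_of_le_tendsto_0 _ (fun i j N hi hj => by
    rw [Real.dist_eq]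
    linarith [hclose i j, hanti hi, hanti hj]) hb0
  obtain ⟨c₀, hc₀⟩ := cauchySeq_tendsto_of_complete hcau
  have hc₀' : ∀ j : ℕ, |c j - c₀| ≤ 2 * (1 / ((j : ℝ) + 1)) := fun j => by
    have h1 : Tendsto (fun i => |c j - c i|) atTop (𝓝 |c j - c₀|) :=
      (tendsto_const_nhds.sub hc₀).abs
    have h2 : Tendsto (fun i : ℕ => 2 * (1 / ((j : ℝ) + 1)) + 2 * (1 / ((i : ℝ) + 1))) atTop
        (𝓝 (2 * (1 / ((j : ℝ) + 1)) + 2 * 0)) :=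
      (tendsto_one_div_add_atTop_nhds_zero_nat.const_mul 2).const_add _
    rw [mul_zero, add_zero] at h2
    exact le_of_tendsto_of_tendsto' h1 h2 fun i => hclose j i
  refine ⟨c₀, fun δ hδ => ?_⟩
  rw [DensityZeroAt, ENNReal.tendsto_nhds_zero]
  intro ε hε
  have h3 : Tendsto (fun j : ℕ => ((j : ℝ≥0∞) + 3)⁻¹) atTop (𝓝 0) :=
    tendsto_of_tendsto_of_tendsto_of_le_of_le tendsto_const_nhds
      ENNReal.tendsto_inv_nat_nhds_zero (fun _ => bot_le)
      fun k => ENNReal.inv_le_inv.2 le_self_add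
  obtain ⟨j, hj1, hj2⟩ := ((hb0.eventually_lt_const hδ).and (h3.eventually_lt_const hε)).exists
  filter_upwards [hc j, self_mem_nhdsWithin] with r hr hr0
  refine ENNReal.div_le_of_le_mul (le_trans (measure_mono ?_) (hr.trans (by gcongr)))
  rintro y ⟨hy, hy2⟩
  refine ⟨?_, hy2⟩
  have hy : δ < |f y - c₀| := hy
  have := abs_sub_le (f y) (c j) c₀
  show 2 * (1 / ((j : ℝ) + 1)) < |f y - c j|
  linarith [hc₀' j]

theorem exists_nullContent_approxLim {n : ℕ} {f : Eu n → ℝ} {g : Eu n → Eu n}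
    (hfm : Measurable f) (hf : Integrable f) (hg : Integrable g)
    (hfg : ∀ φ : Eu n → ℝ, IsTest univ φ → ∫ x, f x • gradient φ x = - ∫ x, φ x • g x) :
    ∃ Z : ℕ → Set (Eu n), (∀ j, NullContent (Z j)) ∧ ∀ x ∉ ⋃ j, Z j, ∃ c, ApproxLim f x c := by
  refine ⟨fun j => _, fun j => nullContent_oscillation hfm hf hg hfg
    (a := ((j : ℝ≥0∞) + 3)⁻¹) (δ := 1 / ((j : ℝ) + 1)) (by simp) ?_ (by positivity),
    fun x hx => exists_approxLim fun j => ?_⟩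
  · rw [one_div]
    exact ENNReal.inv_le_inv.2 (le_trans (by norm_num) le_add_self)
  · have : ¬ _ := fun h => hx (mem_iUnion_of_mem j h)
    simpa only [mem_ofPred_eq, not_forall, not_frequently, not_lt] using this

theorem densityZeroAt_iff_tendsto_dyadic {n : ℕ} {A : Set (Eu n)} {x : Eu n} :
    DensityZeroAt A x ↔ Tendsto (fun j : ℕ => volume (A ∩ ball x ((1 / 2 : ℝ) ^ j)) /
      volume (ball x ((1 / 2 : ℝ) ^ j))) atTop (𝓝 0) := by
  have hpow : Tendsto (fun j : ℕ => (1 / 2 : ℝ) ^ j) atTop (𝓝[>] 0) :=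
    tendsto_nhdsWithin_iff.2 ⟨tendsto_pow_atTop_nhds_zero_of_lt_one (by norm_num) (by norm_num),
      Eventually.of_forall fun j => by simp⟩
  refine ⟨fun h => h.comp hpow, fun h => ?_⟩
  have h2 : Tendsto (fun j : ℕ => 2 ^ n * (volume (A ∩ ball x ((1 / 2 : ℝ) ^ j)) /
      volume (ball x ((1 / 2 : ℝ) ^ j)))) atTop (𝓝 0) := by
    simpa using ENNReal.Tendsto.const_mul h (Or.inr (by simp : (2 : ℝ≥0∞) ^ n ≠ ⊤))
  rw [DensityZeroAt, ENNReal.tendsto_nhds_zero]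
  intro ε hε
  obtain ⟨J, hJ⟩ := eventually_atTop.1 (ENNReal.tendsto_nhds_zero.1 h2 ε hε)
  filter_upwards [Ioo_mem_nhdsGT (by positivity : (0 : ℝ) < (1 / 2) ^ J)] with r hr
  obtain ⟨j, hj1, hj2⟩ := exists_nat_pow_near_of_lt_one hr.1
    (hr.2.le.trans (pow_le_one₀ (by norm_num) (by norm_num))) (by norm_num : (0 : ℝ) < 1 / 2)
    (by norm_num)
  have hJj : J ≤ j := Nat.lt_succ_iff.1
    ((pow_lt_pow_iff_right_of_lt_one₀ (by norm_num) (by norm_num)).1 (hj1.trans hr.2))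
  refine le_trans ?_ (hJ j hJj)
  have hv : volume (ball x ((1 / 2 : ℝ) ^ j)) = 2 ^ n * volume (ball x ((1 / 2 : ℝ) ^ (j + 1))) := by
    rw [← volume_ball_two_mul x (by positivity)]
    congr 2
    rw [pow_succ]
    ring
  have h0 : volume (ball x ((1 / 2 : ℝ) ^ (j + 1))) ≠ 0 :=
    (measure_ball_pos volume x (by positivity)).ne'
  rw [hv, ← mul_div_assoc, ENNReal.mul_div_mul_left _ _ (by simp) (by simp)]
  gcongr

theorem measurableSet_densityZeroAt {n : ℕ} {A : Set (Eu n)} (hA : MeasurableSet A) :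
    MeasurableSet {x | DensityZeroAt A x} := by
  simp only [densityZeroAt_iff_tendsto_dyadic]
  have hm : ∀ {B : Set (Eu n)}, MeasurableSet B → ∀ r : ℝ,
      Measurable fun x => volume (B ∩ ball x r) := fun {B} hB r => by
    have hs : MeasurableSet {p : Eu n × Eu n | p.2 ∈ B ∧ dist p.2 p.1 < r} :=
      (measurable_snd hB).inter
        (isOpen_lt (continuous_snd.dist continuous_fst) continuous_const).measurableSet
    exact measurable_measure_prodMk_left hs
  refine measurableSet_tendsto (𝓝 0) fun j => (hm hA _).div ?_
  simpa using hm MeasurableSet.univ ((1 / 2 : ℝ) ^ j)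

section UpperRep

variable {n : ℕ} {f : Eu n → ℝ} {M : ℝ}

theorem mem_densityZero_levels (hM : ∀ y, |f y| ≤ M) (x : Eu n) :
    M ∈ {t : ℝ | DensityZeroAt {y | t < f y} x} := by
  have : {y | M < f y} = ∅ :=
    eq_empty_of_forall_notMem fun y hy => absurd ((le_abs_self _).trans (hM y)) (not_le.2 hy)
  rw [mem_ofPred_eq, this, DensityZeroAt]
  simp

theorem neg_mem_lowerBounds_densityZero_levels (hM : ∀ y, |f y| ≤ M) (x : Eu n) :
    -M ∈ lowerBounds {t : ℝ | DensityZeroAt {y | t < f y} x} := fun t ht => by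
  by_contra! htM
  refine not_densityZeroAt_univ x (DensityZeroAt.mono ht fun y _ => ?_)
  exact htM.trans_le (neg_le_of_abs_le (hM y))

theorem abs_upperRep_le (hM : ∀ y, |f y| ≤ M) (x : Eu n) : |upperRep f x| ≤ M :=
  abs_le.2 ⟨le_csInf ⟨M, mem_densityZero_levels hM x⟩ fun _ ht =>
      neg_mem_lowerBounds_densityZero_levels hM x ht,
    csInf_le ⟨-M, neg_mem_lowerBounds_densityZero_levels hM x⟩ (mem_densityZero_levels hM x)⟩

theorem measurable_upperRep (hf : Measurable f) (hM : ∀ y, |f y| ≤ M) :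
    Measurable (upperRep f) := by
  refine measurable_of_Iio fun c => ?_
  have : upperRep f ⁻¹' Iio c =
      ⋃ q : ℚ, ⋃ _ : (q : ℝ) < c, {x | DensityZeroAt {y | (q : ℝ) < f y} x} := by
    ext x
    simp only [mem_preimage, mem_Iio, mem_iUnion, mem_ofPred_eq, exists_prop, upperRep]
    rw [csInf_lt_iff ⟨-M, neg_mem_lowerBounds_densityZero_levels hM x⟩
      ⟨M, mem_densityZero_levels hM x⟩]
    constructor
    · rintro ⟨t, ht, htc⟩
      obtain ⟨q, hq1, hq2⟩ := exists_rat_btwn htc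
      exact ⟨q, hq2, DensityZeroAt.mono ht fun y hy => hq1.trans hy⟩
    · rintro ⟨q, hq, hd⟩
      exact ⟨q, hd, hq⟩
  rw [this]
  exact MeasurableSet.iUnion fun q => MeasurableSet.iUnion fun _ =>
    measurableSet_densityZeroAt (measurableSet_lt measurable_const hf)

end UpperRep

theorem upperRep_congr_of_ae {n : ℕ} {f h : Eu n → ℝ} {U : Set (Eu n)} (hU : IsOpen U)
    (hfh : ∀ᵐ x ∂(volume.restrict U), f x = h x) {x : Eu n} (hx : x ∈ U) :
    upperRep f x = upperRep h x := by
  unfold upperRep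
  congr 1
  ext t
  simp only [mem_ofPred_eq, DensityZeroAt]
  obtain ⟨r₀, hr₀, hb⟩ := Metric.isOpen_iff.1 hU x hx
  refine tendsto_congr' ?_
  filter_upwards [Ioo_mem_nhdsGT hr₀] with r hr
  congr 1
  refine measure_congr ?_
  rw [ae_restrict_iff' hU.measurableSet] at hfh
  filter_upwards [hfh] with y hy
  refine propext (and_congr_left fun hyr => ?_)
  have := hy (hb (ball_subset_ball hr.2.le hyr))
  show t < f y ↔ t < h y
  rw [this]

theorem exists_mutuallySingular_add_eq {α : Type*} [MeasurableSpace α] (μ ν : Measure α)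
    [IsFiniteMeasure μ] [IsFiniteMeasure ν] :
    ∃ P N : Measure α, IsFiniteMeasure P ∧ IsFiniteMeasure N ∧ P ⟂ₘ N ∧ μ + N = ν + P := by
  set s := μ.toSignedMeasure - ν.toSignedMeasure with hs
  set j := s.toJordanDecomposition with hj
  refine ⟨j.posPart, j.negPart, inferInstance, inferInstance, j.mutuallySingular, ?_⟩
  have h : j.posPart.toSignedMeasure - j.negPart.toSignedMeasure =
      μ.toSignedMeasure - ν.toSignedMeasure := s.toSignedMeasure_toJordanDecomposition
  rw [← Measure.toSignedMeasure_eq_toSignedMeasure_iff, Measure.toSignedMeasure_add,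
    Measure.toSignedMeasure_add]
  rw [sub_eq_sub_iff_add_eq_add] at h
  rw [← h, add_comm]

theorem integral_sub_integral_eq_of_add_eq {α : Type*} [MeasurableSpace α]
    {μ ν P N : Measure α} (h : μ + N = ν + P) {f : α → ℝ} (hμ : Integrable f μ)
    (hν : Integrable f ν) (hP : Integrable f P) (hN : Integrable f N) :
    ∫ x, f x ∂μ - ∫ x, f x ∂ν = ∫ x, f x ∂P - ∫ x, f x ∂N := by
  have h1 := integral_add_measure hμ hN
  rw [h, integral_add_measure hν hP] at h1
  linarith

theorem integrable_inner_of_bdd {α E : Type*} [MeasurableSpace α] [NormedAddCommGroup E]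
    [InnerProductSpace ℝ E] {μ : Measure α} {σ F : α → E} {C : ℝ}
    (hσm : AEStronglyMeasurable σ μ) (hσ : ∀ᵐ x ∂μ, ‖σ x‖ ≤ C) (hF : Integrable F μ) :
    Integrable (fun x => ⟪σ x, F x⟫) μ := by
  refine (hF.norm.const_mul C).mono' (hσm.inner hF.1) ?_
  filter_upwards [hσ] with x hx
  exact (norm_inner_le_norm _ _).trans (by gcongr)

theorem IsTest.gradient_eq_zero {n : ℕ} {Ω : Set (Eu n)} {φ : Eu n → ℝ} (hφ : IsTest Ω φ)
    {x : Eu n} (hx : x ∉ Ω) : gradient φ x = 0 := by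
  have : fderiv ℝ φ x = 0 := Function.notMem_support.1 fun h =>
    hx (hφ.2.2 (support_fderiv_subset ℝ h))
  rw [gradient, this, map_zero]

theorem IsTest.eq_zero {n : ℕ} {Ω : Set (Eu n)} {φ : Eu n → ℝ} (hφ : IsTest Ω φ)
    {x : Eu n} (hx : x ∉ Ω) : φ x = 0 :=
  image_eq_zero_of_notMem_tsupport fun h => hx (hφ.2.2 h)

theorem IsTest.continuous_gradient {n : ℕ} {Ω : Set (Eu n)} {φ : Eu n → ℝ} (hφ : IsTest Ω φ) :
    Continuous (gradient φ) :=
  (InnerProductSpace.toDual ℝ (Eu n)).symm.continuous.comp (hφ.1.continuous_fderiv (by simp))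

theorem IsTest.hasCompactSupport_gradient {n : ℕ} {Ω : Set (Eu n)} {φ : Eu n → ℝ}
    (hφ : IsTest Ω φ) : HasCompactSupport (gradient φ) :=
  (hφ.2.1.fderiv ℝ).comp_left (g := (InnerProductSpace.toDual ℝ (Eu n)).symm) (map_zero _)

theorem gradient_mul {n : ℕ} {φ ψ : Eu n → ℝ} {x : Eu n} (hφ : DifferentiableAt ℝ φ x)
    (hψ : DifferentiableAt ℝ ψ x) :
    gradient (fun y => φ y * ψ y) x = φ x • gradient ψ x + ψ x • gradient φ x := by
  simp only [gradient]
  rw [fderiv_fun_mul hφ hψ, map_add, map_smulₛₗ, map_smulₛₗ]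
  simp

theorem IsTest.mul_contDiff {n : ℕ} {Ω : Set (Eu n)} {φ ψ : Eu n → ℝ} (hφ : IsTest Ω φ)
    (hψ : ContDiff ℝ (⊤ : ℕ∞) ψ) : IsTest Ω fun x => φ x * ψ x :=
  ⟨hφ.1.mul hψ, hφ.2.1.mul_right, tsupport_mul_subset_left.trans hφ.2.2⟩

theorem RepNegDiv.ae_tendsto_mollify {n : ℕ} {U : Set (Eu n)} (hU : IsOpen U)
    {σ : Eu n → Eu n} {C : ℝ} (hσ : ∀ᵐ x ∂(volume.restrict U), ‖σ x‖ ≤ C) {P N : Measure (Eu n)}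
    [IsFiniteMeasure P] [IsFiniteMeasure N] (hPN : P ⟂ₘ N) (hrep : RepNegDiv U σ P N)
    {f : Eu n → ℝ} {g : Eu n → Eu n} {M : ℝ} (hfm : Measurable f) (hM : ∀ x, |f x| ≤ M)
    (hf : Integrable f) (hg : Integrable g)
    (hfg : ∀ φ : Eu n → ℝ, IsTest univ φ → ∫ x, f x • gradient φ x = - ∫ x, φ x • g x) :
    ∀ᵐ x ∂P, x ∈ U → Tendsto (fun l => mollify l f x) atTop (𝓝 (upperRep f x)) := by
  obtain ⟨Z, hZ, hlim⟩ := exists_nullContent_approxLim hfm hf hg hfg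
  have h0 : P (⋃ j, Z j ∩ U) = 0 :=
    measure_iUnion_null fun j => (hZ j).measure_inter_eq_zero hU hσ hPN hrep
  filter_upwards [measure_eq_zero_iff_ae_notMem.1 h0] with x hx hxU
  rw [← iUnion_inter] at hx
  obtain ⟨c, hc⟩ := hlim x fun h => hx ⟨h, hxU⟩
  rw [hc.upperRep_eq]
  exact hc.tendsto_mollify hfm hM

theorem pairing_eq_of_global {n : ℕ} {U : Set (Eu n)} (hU : IsOpen U)
    {σ : Eu n → Eu n} {C : ℝ} (hσm : AEStronglyMeasurable σ (volume.restrict U))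
    (hσ : ∀ᵐ x ∂(volume.restrict U), ‖σ x‖ ≤ C) {μ ν : Measure (Eu n)}
    [IsFiniteMeasure μ] [IsFiniteMeasure ν] (hrep : RepNegDiv U σ μ ν)
    {f : Eu n → ℝ} {g : Eu n → Eu n} {M : ℝ} (hfm : Measurable f) (hM : ∀ x, |f x| ≤ M)
    (hf : Integrable f) (hg : Integrable g)
    (hfg : ∀ φ : Eu n → ℝ, IsTest univ φ → ∫ x, f x • gradient φ x = - ∫ x, φ x • g x)
    {φ : Eu n → ℝ} (hφ : IsTest U φ) :
    (∫ x in U, f x * ⟪σ x, gradient φ x⟫) + (∫ x in U, φ x * ⟪σ x, g x⟫) =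
      (∫ x, φ x * upperRep f x ∂μ) - ∫ x, φ x * upperRep f x ∂ν := by
  obtain ⟨P, N, _, _, hPN, hadd⟩ := exists_mutuallySingular_add_eq μ ν
  have hφi : ∀ (m : Measure (Eu n)) [IsFiniteMeasure m], Integrable φ m := fun m _ =>
    hφ.integrable m
  have hrep' : RepNegDiv U σ P N := fun ψ hψ => by
    rw [hrep ψ hψ]
    exact integral_sub_integral_eq_of_add_eq hadd (hψ.integrable _) (hψ.integrable _)
      (hψ.integrable _) (hψ.integrable _)
  have hIntg : ∀ (m : Measure (Eu n)) [IsFiniteMeasure m],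
      Integrable (fun x => φ x * upperRep f x) m := fun m _ =>
    (hφi m).mul_bdd (c := M) (measurable_upperRep hfm hM).aestronglyMeasurable
      (ae_of_all _ (abs_upperRep_le hM))
  rw [integral_sub_integral_eq_of_add_eq hadd (hIntg _) (hIntg _) (hIntg _) (hIntg _)]
  have hv := fun l => contDiff_mollify hf.locallyIntegrable l
  have hdom : ∀ (m : Measure (Eu n)) [IsFiniteMeasure m],
      (∀ᵐ x ∂m, x ∈ U → Tendsto (fun l => mollify l f x) atTop (𝓝 (upperRep f x))) →
      Tendsto (fun l => ∫ x, φ x * mollify l f x ∂m) atTop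
        (𝓝 (∫ x, φ x * upperRep f x ∂m)) := fun m _ hm => by
    refine tendsto_integral_of_dominated_convergence (fun x => |φ x| * M)
      (fun l => (hφ.1.continuous.mul (hv l).continuous).aestronglyMeasurable)
      ((hφi m).abs.mul_const M) (fun l => ae_of_all _ fun x => ?_) ?_
    · rw [norm_mul]
      exact mul_le_mul_of_nonneg_left (abs_mollify_le hM l x) (abs_nonneg _)
    · filter_upwards [hm] with x hx
      by_cases hxU : x ∈ U
      · exact (hx hxU).const_mul _
      · simp only [hφ.eq_zero hxU, zero_mul]
        exact tendsto_const_nhds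
  have hlim := (hdom P (hrep'.ae_tendsto_mollify hU hσ hPN hfm hM hf hg hfg)).sub
    (hdom N (hrep'.neg.ae_tendsto_mollify hU (by simpa using hσ) hPN.symm hfm hM hf hg hfg))
  have heq : ∀ l, (∫ x, φ x * mollify l f x ∂P) - ∫ x, φ x * mollify l f x ∂N =
      ∫ x in U, ⟪σ x, φ x • mollify l g x + mollify l f x • gradient φ x⟫ := fun l => by
    rw [← hrep' _ (hφ.mul_contDiff (hv l))]
    simp only [gradient_mul (hφ.1.differentiable (by simp) _) ((hv l).differentiable (by simp) _),
      gradient_mollify hf.locallyIntegrable hfg]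
  simp only [heq] at hlim
  obtain ⟨B₀, hB₀⟩ := hφ.2.1.exists_bound_of_continuous hφ.1.continuous
  obtain ⟨B₁, hB₁⟩ := hφ.hasCompactSupport_gradient.exists_bound_of_continuous
    hφ.continuous_gradient
  have hmf : ∀ l, Integrable (mollify l f) := fun l =>
    ⟨(hv l).continuous.aestronglyMeasurable, (lintegral_enorm_mollify_le hf.1 l).trans_lt hf.2⟩
  have hmg : ∀ l, Integrable (mollify l g) := fun l =>
    ⟨(contDiff_mollify hg.locallyIntegrable l).continuous.aestronglyMeasurable,
      (lintegral_enorm_mollify_le hg.1 l).trans_lt hg.2⟩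
  have hIg : ∀ {G : Eu n → Eu n}, Integrable G → Integrable fun x => φ x • G x := fun hG =>
    hG.bdd_smul B₀ hφ.1.continuous.aestronglyMeasurable (ae_of_all _ hB₀)
  have hIf : ∀ {F : Eu n → ℝ}, Integrable F → Integrable fun x => F x • gradient φ x := fun hF =>
    hF.smul_bdd B₁ hφ.continuous_gradient.aestronglyMeasurable (ae_of_all _ hB₁)
  have hi1 := integrable_inner_of_bdd hσm hσ (hIg hg).integrableOn
  have hi2 := integrable_inner_of_bdd hσm hσ (hIf hf).integrableOn
  have hsplit : (∫ x in U, f x * ⟪σ x, gradient φ x⟫) + (∫ x in U, φ x * ⟪σ x, g x⟫) =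
      ∫ x in U, ⟪σ x, φ x • g x + f x • gradient φ x⟫ := by
    simp only [inner_add_right]
    rw [integral_add hi1 hi2, add_comm]
    simp only [real_inner_smul_right]
  rw [hsplit]
  refine tendsto_nhds_unique ?_ hlim
  refine tendsto_integral_of_L1 _
    (integrable_inner_of_bdd hσm hσ ((hIg hg).add (hIf hf)).integrableOn).1
    (Eventually.of_forall fun l => integrable_inner_of_bdd hσm hσ
      ((hIg (hmg l)).add (hIf (hmf l))).integrableOn) ?_
  have hbound : Tendsto (fun l => ENNReal.ofReal C * (ENNReal.ofReal B₀ *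
      (∫⁻ x, ‖mollify l g x - g x‖ₑ) + ENNReal.ofReal B₁ * ∫⁻ x, ‖mollify l f x - f x‖ₑ)) atTop
      (𝓝 0) := by
    have h1 := ENNReal.Tendsto.const_mul (tendsto_lintegral_enorm_mollify_sub hg)
      (Or.inr (ENNReal.ofReal_ne_top (r := B₀)))
    have h2 := ENNReal.Tendsto.const_mul (tendsto_lintegral_enorm_mollify_sub hf)
      (Or.inr (ENNReal.ofReal_ne_top (r := B₁)))
    simpa using ENNReal.Tendsto.const_mul (h1.add h2) (Or.inr (ENNReal.ofReal_ne_top (r := C)))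
  refine tendsto_of_tendsto_of_tendsto_of_le_of_le tendsto_const_nhds hbound (fun _ => bot_le)
    fun l => ?_
  have hm1 : AEMeasurable (fun x => ‖mollify l g x - g x‖ₑ) volume := ((hmg l).sub hg).1.enorm
  have hm2 : AEMeasurable (fun x => ‖mollify l f x - f x‖ₑ) volume := ((hmf l).sub hf).1.enorm
  have hpt : ∀ᵐ x ∂(volume.restrict U),
      ‖⟪σ x, φ x • mollify l g x + mollify l f x • gradient φ x⟫ -
        ⟪σ x, φ x • g x + f x • gradient φ x⟫‖ₑ ≤
      ENNReal.ofReal C * (ENNReal.ofReal B₀ * ‖mollify l g x - g x‖ₑ +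
        ENNReal.ofReal B₁ * ‖mollify l f x - f x‖ₑ) := by
    filter_upwards [hσ] with x hx
    have hv : φ x • mollify l g x + mollify l f x • gradient φ x -
        (φ x • g x + f x • gradient φ x) =
        φ x • (mollify l g x - g x) + (mollify l f x - f x) • gradient φ x := by
      module
    have hC : 0 ≤ C := (norm_nonneg _).trans hx
    have hB0 : 0 ≤ B₀ := (norm_nonneg _).trans (hB₀ x)
    have hB1 : 0 ≤ B₁ := (norm_nonneg _).trans (hB₁ x)
    rw [← inner_sub_right, hv]
    simp only [← ofReal_norm]
    rw [← ENNReal.ofReal_mul hB0, ← ENNReal.ofReal_mul hB1, ← ENNReal.ofReal_add (by positivity)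
      (by positivity), ← ENNReal.ofReal_mul hC]
    refine ENNReal.ofReal_le_ofReal ((norm_inner_le_norm _ _).trans ?_)
    refine mul_le_mul hx ((norm_add_le _ _).trans ?_) (norm_nonneg _) hC
    rw [norm_smul, norm_smul, mul_comm ‖mollify l f x - f x‖]
    gcongr
    · exact hB₀ x
    · exact hB₁ x
  calc _ ≤ _ := lintegral_mono_ae hpt
    _ ≤ ∫⁻ x, ENNReal.ofReal C * (ENNReal.ofReal B₀ * ‖mollify l g x - g x‖ₑ +
        ENNReal.ofReal B₁ * ‖mollify l f x - f x‖ₑ) := lintegral_mono' Measure.restrict_le_self le_rfl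
    _ = _ := by
      rw [lintegral_const_mul' _ _ ENNReal.ofReal_ne_top,
        lintegral_add_left' (hm1.const_mul _), lintegral_const_mul' _ _ ENNReal.ofReal_ne_top,
        lintegral_const_mul' _ _ ENNReal.ofReal_ne_top]

theorem RepNegDiv.restrict {n : ℕ} {Ω U : Set (Eu n)} {σ : Eu n → Eu n}
    {μ ν : Measure (Eu n)} (h : RepNegDiv Ω σ μ ν) (hUΩ : U ⊆ Ω) :
    RepNegDiv U σ (μ.restrict U) (ν.restrict U) := fun φ hφ => by
  rw [setIntegral_eq_integral_of_forall_compl_eq_zero fun x hx => hφ.eq_zero hx,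
    setIntegral_eq_integral_of_forall_compl_eq_zero fun x hx => hφ.eq_zero hx,
    ← h φ ⟨hφ.1, hφ.2.1, hφ.2.2.trans hUΩ⟩,
    setIntegral_eq_integral_of_forall_compl_eq_zero fun x hx => by
      rw [hφ.gradient_eq_zero hx, inner_zero_right],
    setIntegral_eq_integral_of_forall_compl_eq_zero fun x hx => by
      rw [hφ.gradient_eq_zero fun hxU => hx (hUΩ hxU), inner_zero_right]]

/-- The product rule for a cutoff times a function with locally integrable weak gradient. -/
theorem HasSobGradLoc.cutoff {n : ℕ} {Ω : Set (Eu n)} {u χ : Eu n → ℝ}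
    {g : Eu n → Eu n} (hu : LocallyIntegrableOn u Ω) (hg : HasSobGradLoc Ω u g)
    (hχ : IsTest Ω χ) :
    Integrable (fun x => χ x * u x) ∧ Integrable (fun x => χ x • g x + u x • gradient χ x) ∧
      ∀ φ : Eu n → ℝ, IsTest univ φ → ∫ x, (χ x * u x) • gradient φ x =
        - ∫ x, φ x • (χ x • g x + u x • gradient χ x) := by
  set K := tsupport χ
  have hK : IsCompact K := hχ.2.1
  have huK : IntegrableOn u K := hu.integrableOn_compact_subset hχ.2.2 hK
  have hgK : IntegrableOn g K := hg.1.integrableOn_compact_subset hχ.2.2 hK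
  have hχK : IsTest K χ := ⟨hχ.1, hχ.2.1, subset_rfl⟩
  obtain ⟨B₀, hB₀⟩ := hχ.2.1.exists_bound_of_continuous hχ.1.continuous
  obtain ⟨B₁, hB₁⟩ := hχ.hasCompactSupport_gradient.exists_bound_of_continuous
    hχ.continuous_gradient
  have h1 : Integrable (fun x => χ x • g x) :=
    (integrableOn_iff_integrable_of_support_subset fun x hx => by
      by_contra hxK; exact hx (by simp [hχK.eq_zero hxK])).1
      (hgK.bdd_smul B₀ hχ.1.continuous.aestronglyMeasurable (ae_of_all _ hB₀))
  have h2 : Integrable (fun x => u x • gradient χ x) :=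
    (integrableOn_iff_integrable_of_support_subset fun x hx => by
      by_contra hxK; exact hx (by simp [hχK.gradient_eq_zero hxK])).1
      (huK.smul_bdd B₁ hχ.continuous_gradient.aestronglyMeasurable (ae_of_all _ hB₁))
  have h3 : Integrable (fun x => χ x * u x) :=
    (integrableOn_iff_integrable_of_support_subset fun x hx => by
      by_contra hxK; exact hx (by simp [hχK.eq_zero hxK])).1
      (huK.bdd_smul B₀ hχ.1.continuous.aestronglyMeasurable (ae_of_all _ hB₀))
  refine ⟨h3, h1.add h2, fun φ hφ => ?_⟩
  obtain ⟨D₀, hD₀⟩ := hφ.2.1.exists_bound_of_continuous hφ.1.continuous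
  obtain ⟨D₁, hD₁⟩ := hφ.hasCompactSupport_gradient.exists_bound_of_continuous
    hφ.continuous_gradient
  have h4 : Integrable (fun x => (χ x * u x) • gradient φ x) :=
    h3.smul_bdd D₁ hφ.continuous_gradient.aestronglyMeasurable (ae_of_all _ hD₁)
  have h5 : Integrable (fun x => φ x • (χ x • g x)) :=
    h1.bdd_smul D₀ hφ.1.continuous.aestronglyMeasurable (ae_of_all _ hD₀)
  have h6 : Integrable (fun x => φ x • (u x • gradient χ x)) :=
    h2.bdd_smul D₀ hφ.1.continuous.aestronglyMeasurable (ae_of_all _ hD₀)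
  have hχφ : IsTest Ω fun x => χ x * φ x := hχ.mul_contDiff hφ.1
  have h := hg.2 _ hχφ
  rw [setIntegral_eq_integral_of_forall_compl_eq_zero fun x hx => by
      rw [hχφ.gradient_eq_zero hx, smul_zero],
    setIntegral_eq_integral_of_forall_compl_eq_zero fun x hx => by
      rw [hχφ.eq_zero hx, zero_smul]] at h
  have e1 : ∀ x, u x • gradient (fun y => χ y * φ y) x =
      (χ x * u x) • gradient φ x + φ x • (u x • gradient χ x) := fun x => by
    rw [gradient_mul (hχ.1.differentiable (by simp) x) (hφ.1.differentiable (by simp) x)]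
    module
  have e2 : ∀ x, (χ x * φ x) • g x = φ x • (χ x • g x) := fun x => by module
  simp only [e1, e2] at h
  rw [integral_add h4 h6] at h
  simp only [smul_add (φ _)]
  rw [integral_add h5 h6, neg_add, ← h]
  abel

theorem exists_bounded_modification {n : ℕ} {f : Eu n → ℝ} {M : ℝ}
    (hf : AEStronglyMeasurable f volume) (hM : ∀ᵐ x, |f x| ≤ M) (hM0 : 0 ≤ M) :
    ∃ h : Eu n → ℝ, Measurable h ∧ (∀ x, |h x| ≤ M) ∧ h =ᵐ[volume] f := by
  refine ⟨fun x => max (-M) (min M (hf.mk f x)),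
    measurable_const.max (measurable_const.min hf.stronglyMeasurable_mk.measurable),
    fun x => abs_le.2 ⟨le_max_left _ _, max_le (by linarith) (min_le_left _ _)⟩, ?_⟩
  filter_upwards [hf.ae_eq_mk, hM] with x hx hxM
  rw [← hx, min_eq_right (abs_le.1 hxM).2, max_eq_right (abs_le.1 hxM).1]

/-- the local pairing trivializes on `W^{1,1}`-functions:
for `u ∈ W^{1,1}_loc(Ω) ∩ L^∞_loc(Ω)` with weak gradient `g` and a divergence-measure
field `σ` with `Div σ = μn - μp`, the pairing `⟨σ, Du⁺⟩(φ)` equals `∫ φ σ·Du dx`. -/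
theorem stmt4 {n : ℕ} (Ω : Set (Eu n)) (hΩ : IsOpen Ω)
    (σ : Eu n → Eu n) (hσ : LocBdd Ω σ) (μp μn : Measure (Eu n))
    (hp : LocFinOn Ω μp) (hn : LocFinOn Ω μn) (hrep : RepNegDiv Ω σ μp μn)
    (u : Eu n → ℝ) (g : Eu n → Eu n) (hu : LocallyIntegrableOn u Ω)
    (hg : HasSobGradLoc Ω u g) (hub : LocBddFun Ω u) :
    ∀ φ : Eu n → ℝ, IsTest Ω φ →
      (- ∫ x in Ω, u x * ⟪σ x, gradient φ x⟫)
        - ((∫ x, φ x * upperRep u x ∂μn) - ∫ x, φ x * upperRep u x ∂μp)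
        = ∫ x in Ω, φ x * ⟪σ x, g x⟫ := by
  intro φ hφ
  obtain ⟨U, hU, hφU, hUΩ, hUc⟩ :=
    exists_open_between_and_isCompact_closure hφ.2.1.isCompact hΩ hφ.2.2
  have hUΩ' : U ⊆ Ω := subset_closure.trans hUΩ
  have hφ' : IsTest U φ := ⟨hφ.1, hφ.2.1, hφU⟩
  obtain ⟨χ, hχ, hχ01, W, hW, hUW, hχW⟩ := exists_isTest_one_nhds hUc hΩ hUΩ
  obtain ⟨hf, hG, hfG⟩ := hg.cutoff hu hχ
  obtain ⟨M, hM⟩ := hub.2 _ hχ.2.2 hχ.2.1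
  have hbd : ∀ᵐ x, |χ x * u x| ≤ |M| := by
    rw [ae_restrict_iff' hχ.2.1.isCompact.measurableSet] at hM
    filter_upwards [hM] with x hx
    by_cases hxK : x ∈ tsupport χ
    · rw [abs_mul, abs_of_nonneg (hχ01 x).1]
      exact (mul_le_of_le_one_left (abs_nonneg _) (hχ01 x).2).trans
        ((hx hxK).trans (le_abs_self M))
    · rw [image_eq_zero_of_notMem_tsupport hxK, zero_mul, abs_zero]
      exact abs_nonneg _
  obtain ⟨f, hfm, hfM, hfe⟩ := exists_bounded_modification hf.1 hbd (abs_nonneg M)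
  have hfG' : ∀ ψ : Eu n → ℝ, IsTest univ ψ → ∫ x, f x • gradient ψ x =
      - ∫ x, ψ x • (χ x • g x + u x • gradient χ x) := fun ψ hψ => by
    rw [← hfG ψ hψ]
    refine integral_congr_ae ?_
    filter_upwards [hfe] with x hx
    rw [hx]
  have hfu : ∀ᵐ x ∂(volume.restrict U), u x = f x := by
    rw [ae_restrict_iff' hU.measurableSet]
    filter_upwards [hfe] with x hx hxU
    rw [hx, hχW x (hUW (subset_closure hxU)), one_mul]
  have hGg : ∀ x ∈ U, χ x • g x + u x • gradient χ x = g x := fun x hx => by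
    have hxW := hUW (subset_closure hx)
    have hc : χ =ᶠ[𝓝 x] fun _ => 1 := by
      filter_upwards [hW.mem_nhds hxW] with y hy using hχW y hy
    have hd : gradient χ x = 0 := by
      rw [gradient, hc.fderiv_eq, fderiv_const_apply, map_zero]
    rw [hχW x hxW, hd, one_smul, smul_zero, add_zero]
  obtain ⟨C, hC⟩ := hσ.2 _ hUΩ hUc
  have hμ : ∀ {μ : Measure (Eu n)}, LocFinOn Ω μ → IsFiniteMeasure (μ.restrict U) := fun h =>
    ⟨by rw [Measure.restrict_apply_univ]
        exact (measure_mono subset_closure).trans_lt (h.1 _ hUΩ hUc)⟩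
  have := hμ hp
  have := hμ hn
  have key := pairing_eq_of_global hU (hσ.1.mono_measure (Measure.restrict_mono hUΩ' le_rfl))
    (ae_restrict_of_ae_restrict_of_subset subset_closure hC) (hrep.restrict hUΩ') hfm hfM
    (hf.congr hfe.symm) hG hfG' hφ'
  have hrepr : ∀ μ : Measure (Eu n), ∫ x, φ x * upperRep f x ∂(μ.restrict U) =
      ∫ x, φ x * upperRep u x ∂μ := fun μ => by
    rw [← setIntegral_eq_integral_of_forall_compl_eq_zero (s := U) (μ := μ) fun x hx => by
      rw [hφ'.eq_zero hx, zero_mul]]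
    refine setIntegral_congr_fun hU.measurableSet fun x hx => ?_
    simp only [upperRep_congr_of_ae hU hfu hx]
  have hfirst : ∫ x in U, f x * ⟪σ x, gradient φ x⟫ = ∫ x in Ω, u x * ⟪σ x, gradient φ x⟫ := by
    rw [setIntegral_eq_of_subset_of_forall_sdiff_eq_zero hΩ.measurableSet hUΩ' fun x hx => by
      rw [hφ'.gradient_eq_zero hx.2, inner_zero_right, mul_zero]]
    refine integral_congr_ae ?_
    filter_upwards [hfu] with x hx
    rw [hx]
  have hsecond : ∫ x in U, φ x * ⟪σ x, χ x • g x + u x • gradient χ x⟫ =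
      ∫ x in Ω, φ x * ⟪σ x, g x⟫ := by
    rw [setIntegral_eq_of_subset_of_forall_sdiff_eq_zero hΩ.measurableSet hUΩ' fun x hx => by
      rw [hφ'.eq_zero hx.2, zero_mul]]
    refine setIntegral_congr_fun hU.measurableSet fun x hx => ?_
    simp only [hGg x hx]
  rw [hrepr, hrepr, hfirst, hsecond] at key
  linarith
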